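/- arXiv:2603.01721 — 4 statements merged into one kernel-verified Lean document; each statement's English description precedes it below -/
import Mathlib

section
/- For every u₁, u₂ ∈ (0,1) and every real number c satisfying max(u₁+u₂−1, 0) ≤ c ≤ min(u₁, u₂), there exists exactly one ρ ∈ [−1,1] such that Φ₂(Φ⁻¹(u₁), Φ⁻¹(u₂); ρ) = c. (This is the pointwise local Gaussian representation: every admissible bivariate copula value admits a unique local Gaussian correlation parameter.) -/
open MeasureTheory Real Set Filter

/-- Standard univariate normal cdf Φ. -/
noncomputable def stdNormalCDF (z : ℝ) : ℝ :=
  ∫ x in Set.Iic z, (Real.sqrt (2 * Real.pi))⁻¹ * Real.exp (-(x ^ 2) / 2)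

/-- Φ⁻¹, the (left-)inverse of the standard normal cdf. -/
noncomputable def stdNormalInv : ℝ → ℝ := Function.invFun stdNormalCDF

/-- Standard bivariate normal density φ₂(x,y;ρ), ρ ∈ (−1,1). -/
noncomputable def phi2 (ρ x y : ℝ) : ℝ :=
  (2 * Real.pi * Real.sqrt (1 - ρ ^ 2))⁻¹ *
    Real.exp (-(x ^ 2 - 2 * ρ * x * y + y ^ 2) / (2 * (1 - ρ ^ 2)))

/-- Standard bivariate normal cdf Φ₂(z₁,z₂;ρ) = ∫_{−∞}^{z₁} ∫_{−∞}^{z₂} φ₂(x,y;ρ) dy dx. -/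
noncomputable def Phi2 (ρ z₁ z₂ : ℝ) : ℝ :=
  ∫ x in Set.Iic z₁, ∫ y in Set.Iic z₂, phi2 ρ x y

/-- Extension of Φ₂ to ρ ∈ [−1,1], with Fréchet–Hoeffding values at the endpoints. -/
noncomputable def Phi2ext (ρ z₁ z₂ : ℝ) : ℝ :=
  if ρ = 1 then min (stdNormalCDF z₁) (stdNormalCDF z₂)
  else if ρ = -1 then max (stdNormalCDF z₁ + stdNormalCDF z₂ - 1) 0
  else Phi2 ρ z₁ z₂

namespace LG
noncomputable def g (x : ℝ) : ℝ := (Real.sqrt (2 * Real.pi))⁻¹ * Real.exp (-(x ^ 2) / 2)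

lemma g_pos (x : ℝ) : 0 < g x := by unfold g; positivity

lemma g_cont : Continuous g := by unfold g; fun_prop

lemma g_neg (x : ℝ) : g (-x) = g x := by simp [g]

lemma g_le_one (x : ℝ) : g x ≤ 1 := by
  unfold g
  have h1 : (1:ℝ) ≤ Real.sqrt (2 * Real.pi) := by
    rw [Real.one_le_sqrt]; nlinarith [Real.pi_gt_three]
  have h2 : (Real.sqrt (2 * Real.pi))⁻¹ ≤ 1 := inv_le_one_of_one_le₀ h1
  have h3 : Real.exp (-(x ^ 2) / 2) ≤ 1 := by
    rw [Real.exp_le_one_iff]; nlinarith [sq_nonneg x]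
  exact mul_le_one₀ h2 (Real.exp_pos _).le h3

lemma g_int : Integrable g := by
  have := (integrable_exp_neg_mul_sq (b := 1/2) (by norm_num)).const_mul (Real.sqrt (2 * Real.pi))⁻¹
  refine this.congr (Eventually.of_forall fun x => ?_)
  simp only [g]; congr 2; ring

lemma xg_int : Integrable (fun x => |x| * g x) := by
  have := ((integrable_mul_exp_neg_mul_sq (b := 1/2) (by norm_num)).const_mul (Real.sqrt (2 * Real.pi))⁻¹).norm
  refine this.congr (Eventually.of_forall fun x => ?_)
  simp only [g, norm_mul, Real.norm_eq_abs, Real.abs_exp]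
  rw [abs_of_nonneg (by positivity : (0:ℝ) ≤ (Real.sqrt (2 * Real.pi))⁻¹)]
  rw [show -(1/2) * x^2 = -(x^2)/2 by ring]; ring

lemma g_total : ∫ x, g x = 1 := by
  have h := integral_gaussian (1/2)
  simp only [g]
  rw [integral_const_mul]
  have : (fun x : ℝ => Real.exp (-(x ^ 2) / 2)) = fun x => Real.exp (-(1/2) * x^2) := by
    funext x; congr 1; ring
  rw [this, h, show π / (1/2) = 2 * π by ring]
  exact inv_mul_cancel₀ (by positivity)

lemma g_deriv (x : ℝ) : HasDerivAt g (-x * g x) x := by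
  have h1 : HasDerivAt (fun x : ℝ => -(x ^ 2) / 2) (-x) x := by
    have := ((hasDerivAt_pow 2 x).neg).div_const 2
    convert! this using 1
    simp; ring
  have := (h1.exp).const_mul (Real.sqrt (2 * Real.pi))⁻¹
  convert! this using 1
  simp only [g]; ring

lemma g_bot : Tendsto g atBot (nhds 0) := by
  have h1 : Tendsto (fun x : ℝ => -(x ^ 2) / 2) atBot atBot := by
    have : Tendsto (fun x : ℝ => x ^ 2) atBot atTop := by
      have := (tendsto_pow_atTop (α := ℝ) (n := 2) (by norm_num)).comp tendsto_neg_atBot_atTop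
      refine this.congr fun x => by simp
    exact (tendsto_neg_atTop_atBot.comp this).atBot_div_const (by norm_num)
  have := (Real.tendsto_exp_atBot.comp h1).const_mul (Real.sqrt (2 * Real.pi))⁻¹
  rw [mul_zero] at this
  exact this

lemma cdf_eq (z : ℝ) : stdNormalCDF z = ∫ x in Iic z, g x := rfl

lemma cdf_sub (y z : ℝ) : stdNormalCDF z - stdNormalCDF y = ∫ x in y..z, g x :=
  intervalIntegral.integral_Iic_sub_Iic g_int.integrableOn g_int.integrableOn

lemma cdf_deriv (z : ℝ) : HasDerivAt stdNormalCDF (g z) z := by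
  have h := (g_cont.integral_hasStrictDerivAt 0 z).hasDerivAt.const_add (stdNormalCDF 0)
  convert! h using 1
  funext u
  rw [← cdf_sub]; ring

lemma cdf_cont : Continuous stdNormalCDF :=
  continuous_iff_continuousAt.2 fun z => (cdf_deriv z).continuousAt

lemma cdf_mono : Monotone stdNormalCDF :=
  monotone_of_deriv_nonneg (fun z => (cdf_deriv z).differentiableAt)
    fun z => by rw [(cdf_deriv z).deriv]; exact (g_pos z).le

lemma cdf_neg (z : ℝ) : stdNormalCDF (-z) = 1 - stdNormalCDF z := by
  have h1 : stdNormalCDF (-z) = ∫ x in Ioi z, g x := by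
    have := integral_comp_neg_Iic (-z) g
    simp only [g_neg, neg_neg] at this
    exact this
  have h2 := integral_add_compl (measurableSet_Iic (a := z)) g_int
  rw [compl_Iic, g_total] at h2
  rw [h1, cdf_eq]; linarith

lemma cdf_top : Tendsto stdNormalCDF atTop (nhds 1) := by
  have := (aecover_Iic (μ := volume) (tendsto_id (α := ℝ) (x := atTop))).integral_tendsto_of_countably_generated g_int
  rw [g_total] at this
  exact this

lemma cdf_bot : Tendsto stdNormalCDF atBot (nhds 0) := by
  have := (cdf_top.comp tendsto_neg_atBot_atTop).const_sub 1
  rw [sub_self] at this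
  refine this.congr fun x => ?_
  simp [cdf_neg]

lemma cdf_nonneg (z : ℝ) : 0 ≤ stdNormalCDF z :=
  setIntegral_nonneg measurableSet_Iic fun x _ => (g_pos x).le

lemma cdf_le_one (z : ℝ) : stdNormalCDF z ≤ 1 := by
  have := cdf_nonneg (-z); rw [cdf_neg] at this; linarith

lemma cdf_inv {u : ℝ} (hu : u ∈ Ioo (0:ℝ) 1) : stdNormalCDF (stdNormalInv u) = u := by
  apply Function.invFun_eq
  obtain ⟨y, hy⟩ := (cdf_bot.eventually (gt_mem_nhds hu.1)).exists
  obtain ⟨z, hz⟩ := (cdf_top.eventually (lt_mem_nhds hu.2)).exists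
  exact mem_range_of_exists_le_of_exists_ge cdf_cont ⟨y, hy.le⟩ ⟨z, hz.le⟩

lemma inner_eq {ρ : ℝ} (hρ : ρ ∈ Ioo (-1:ℝ) 1) (b x : ℝ) :
    ∫ y in Iic b, phi2 ρ x y = g x * stdNormalCDF ((b - ρ * x) / Real.sqrt (1 - ρ^2)) := by
  have hp : 0 < 1 - ρ^2 := by nlinarith [hρ.1, hρ.2]
  set s := Real.sqrt (1 - ρ^2) with hs
  have hs0 : 0 < s := Real.sqrt_pos.2 hp
  have hss : s^2 = 1 - ρ^2 := Real.sq_sqrt hp.le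
  have key : ∀ y, phi2 ρ x y = g x * (g ((y - ρ * x)/s) * (1/s)) := by
    intro y
    unfold phi2 g
    rw [← hs, ← hss]
    have e : -(x ^ 2 - 2 * ρ * x * y + y ^ 2) / (2 * s^2) =
        -(x^2)/2 + -(((y - ρ * x)/s)^2)/2 := by
      field_simp
      rw [hss]; ring
    rw [e, Real.exp_add]
    have : (2 * π * s)⁻¹ = (√(2*π))⁻¹ * (√(2*π))⁻¹ * (1/s) := by
      rw [← mul_inv, Real.mul_self_sqrt (by positivity)]; field_simp
    rw [this]; ring
  simp only [key]
  have hd : ∀ y, HasDerivAt (fun y => g x * stdNormalCDF ((y - ρ * x)/s))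
      (g x * (g ((y - ρ * x)/s) * (1/s))) y := by
    intro y
    have h1 : HasDerivAt (fun y => (y - ρ * x)/s) (1/s) y :=
      ((hasDerivAt_id y).sub_const _).div_const s
    exact ((cdf_deriv _).comp y h1).const_mul _
  have hl : Tendsto (fun y => g x * stdNormalCDF ((y - ρ * x)/s)) atBot (nhds 0) := by
    have h1 : Tendsto (fun y => (y - ρ * x)/s) atBot atBot :=
      (tendsto_atBot_add_const_right _ (-(ρ*x)) tendsto_id).atBot_div_const hs0
    have := (cdf_bot.comp h1).const_mul (g x)
    rwa [mul_zero] at this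
  have hi : Integrable (fun y => g x * (g ((y - ρ * x)/s) * (1/s))) :=
    (((g_int.comp_div hs0.ne').comp_sub_right (ρ * x)).mul_const _).const_mul _
  have := integral_Iic_of_hasDerivAt_of_tendsto (a := b) (hd b).continuousAt.continuousWithinAt
    (fun y _ => hd y) hi.integrableOn hl
  rw [this, sub_zero]

lemma Phi2_eq {ρ : ℝ} (hρ : ρ ∈ Ioo (-1:ℝ) 1) (a b : ℝ) :
    Phi2 ρ a b = ∫ x in Iic a, g x * stdNormalCDF ((b - ρ * x) / Real.sqrt (1 - ρ^2)) := by
  unfold Phi2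
  simp only [inner_eq hρ]

lemma meas (ρ b : ℝ) : Continuous fun x => g x * stdNormalCDF ((b - ρ * x) / Real.sqrt (1 - ρ^2)) := by
  have := g_cont
  have := cdf_cont
  fun_prop

lemma bnd (ρ b x : ℝ) : ‖g x * stdNormalCDF ((b - ρ * x) / Real.sqrt (1 - ρ^2))‖ ≤ g x := by
  rw [Real.norm_eq_abs, abs_of_nonneg (mul_nonneg (g_pos x).le (cdf_nonneg _))]
  exact mul_le_of_le_one_right (g_pos x).le (cdf_le_one _)

lemma Phi2_deriv {r : ℝ} (hr : r ∈ Ioo (-1:ℝ) 1) (a b : ℝ) :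
    ∃ d > 0, HasDerivAt (fun ρ => Phi2 ρ a b) d r := by
  obtain ⟨t, ht1, ht2⟩ := exists_between (abs_lt.2 hr)
  have ht0 : 0 ≤ t := (abs_nonneg r).trans ht1.le
  have hq : 0 < 1 - t^2 := by nlinarith
  set C := (Real.sqrt (1 - t^2) ^ 3)⁻¹ with hC
  have hC0 : 0 < C := by positivity
  have hnhd : Ioo (-t) t ∈ nhds r := Ioo_mem_nhds (abs_lt.1 ht1).1 (abs_lt.1 ht1).2
  let F' : ℝ → ℝ → ℝ := fun ρ x =>
    g x * (g ((b - ρ * x) / Real.sqrt (1 - ρ^2)) * ((ρ * b - x) / Real.sqrt (1 - ρ^2)^3))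
  have hF'c : ∀ ρ, Continuous (F' ρ) := by
    intro ρ
    have := g_cont
    simp only [F']
    fun_prop
  have hmain := hasDerivAt_integral_of_dominated_loc_of_deriv_le (μ := volume.restrict (Iic a))
    (F := fun ρ x => g x * stdNormalCDF ((b - ρ * x) / Real.sqrt (1 - ρ^2))) (F' := F')
    (bound := fun x => (|b| * C) * g x + C * (|x| * g x)) (x₀ := r) hnhd
    (Eventually.of_forall fun ρ => (meas ρ b).aestronglyMeasurable)
    ((g_int.mono' (meas r b).aestronglyMeasurable
      (Eventually.of_forall fun x => bnd r b x)).integrableOn)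
    (hF'c r).aestronglyMeasurable
    (Eventually.of_forall fun x ρ hρ => by
      have hp : 1 - t^2 ≤ 1 - ρ^2 := by nlinarith [hρ.1, hρ.2]
      have hρ1 : |ρ| ≤ 1 := (abs_lt.2 ⟨hρ.1, hρ.2⟩).le.trans ht2.le
      have hsq : Real.sqrt (1 - t^2) ≤ Real.sqrt (1 - ρ^2) := Real.sqrt_le_sqrt hp
      have hsq0 : 0 < Real.sqrt (1 - t^2) := Real.sqrt_pos.2 hq
      have hs0 := hsq0.trans_le hsq
      have h1 : (Real.sqrt (1 - ρ^2)^3)⁻¹ ≤ C := by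
        rw [hC]; gcongr
      have h2 : |ρ * b - x| ≤ |b| + |x| := by
        refine (abs_sub _ _).trans ?_
        rw [abs_mul]
        have := mul_le_of_le_one_left (abs_nonneg b) hρ1
        linarith
      simp only [F', norm_mul, Real.norm_eq_abs, abs_of_pos (g_pos _), div_eq_mul_inv (ρ * b - x),
        abs_mul (ρ * b - x)]
      rw [abs_of_pos (by positivity : 0 < (Real.sqrt (1 - ρ^2)^3)⁻¹)]
      calc g x * (g _ * (|ρ * b - x| * (Real.sqrt (1 - ρ^2)^3)⁻¹))
          ≤ g x * (1 * ((|b| + |x|) * C)) := by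
            have := (g_pos x).le
            have := g_le_one ((b - ρ * x) / Real.sqrt (1 - ρ^2))
            gcongr
        _ = _ := by ring)
    (((g_int.const_mul _).add (xg_int.const_mul _)).integrableOn)
    (Eventually.of_forall fun x ρ hρ => by
      have hp : 0 < 1 - ρ^2 := by nlinarith [hρ.1, hρ.2]
      have hs0 : 0 < Real.sqrt (1 - ρ^2) := Real.sqrt_pos.2 hp
      have hss : Real.sqrt (1 - ρ^2)^2 = 1 - ρ^2 := Real.sq_sqrt hp.le
      have hsd : HasDerivAt (fun ρ : ℝ => Real.sqrt (1 - ρ^2))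
          (-(2*ρ) / (2 * Real.sqrt (1 - ρ^2))) ρ := by
        have : HasDerivAt (fun ρ : ℝ => 1 - ρ^2) (-(2*ρ)) ρ := by
          simpa using (hasDerivAt_pow 2 ρ).const_sub 1
        exact this.sqrt hp.ne'
      have hn : HasDerivAt (fun ρ : ℝ => b - ρ * x) (-x) ρ := by
        simpa using ((hasDerivAt_id ρ).mul_const x).const_sub b
      have hh := hn.fun_div hsd hs0.ne'
      have := ((cdf_deriv _).comp ρ hh).const_mul (g x)
      convert! this using 1
      simp only [F']
      congr 2
      field_simp
      rw [hss]; ring)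
  have hp : 0 < 1 - r^2 := by nlinarith [hr.1, hr.2]
  have hs0 : 0 < Real.sqrt (1 - r^2) := Real.sqrt_pos.2 hp
  have hss : Real.sqrt (1 - r^2)^2 = 1 - r^2 := Real.sq_sqrt hp.le
  set s := Real.sqrt (1 - r^2) with hs
  have hval : ∫ x in Iic a, F' r x = g a * (g ((b - r * a)/s) / s) := by
    have hd : ∀ x, HasDerivAt (fun x => g x * (g ((b - r * x)/s) / s)) (F' r x) x := by
      intro x
      have hn : HasDerivAt (fun x : ℝ => (b - r * x)/s) (-r/s) x := by
        simpa using (((hasDerivAt_id x).const_mul r).const_sub b).div_const s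
      have h2 := (((g_deriv _).comp x hn).div_const s)
      have := (g_deriv x).mul h2
      convert! this using 1
      simp only [F', ← hs, Function.comp]
      field_simp
      rw [hss]; ring
    have hl : Tendsto (fun x => g x * (g ((b - r * x)/s) / s)) atBot (nhds 0) := by
      have h0 : Tendsto (fun x => g x * (1 / s)) atBot (nhds 0) := by
        simpa using g_bot.mul_const (1/s)
      refine squeeze_zero (fun x => ?_) (fun x => ?_) h0
      · have := g_pos x
        have := g_pos ((b - r * x)/s)
        positivity
      · have := (g_pos x).le
        have := g_le_one ((b - r * x)/s)
        gcongr
    have := integral_Iic_of_hasDerivAt_of_tendsto (a := a) (hd a).continuousAt.continuousWithinAt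
      (fun y _ => hd y) hmain.1 hl
    rw [this, sub_zero]
  refine ⟨g a * (g ((b - r * a)/s) / s), ?_, ?_⟩
  · have := g_pos a
    have := g_pos ((b - r * a)/s)
    positivity
  · rw [← hval]
    refine hmain.2.congr_of_eventuallyEq ?_
    filter_upwards [Ioo_mem_nhds hr.1 hr.2] with ρ hρ
    exact Phi2_eq hρ a b

lemma lim_aux (a b e : ℝ) (he : e = 1 ∨ e = -1) (L : ℝ → ℝ)
    (hL1 : ∀ x, e * x < b → L x = g x) (hL2 : ∀ x, b < e * x → L x = 0) :
    Tendsto (fun ρ => Phi2 ρ a b) (nhdsWithin e (Ioo (-1) 1)) (nhds (∫ x in Iic a, L x)) := by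
  have hev : ∀ᶠ ρ in nhdsWithin e (Ioo (-1:ℝ) 1), ρ ∈ Ioo (-1:ℝ) 1 := self_mem_nhdsWithin
  have hT : Tendsto (fun ρ => ∫ x in Iic a, g x * stdNormalCDF ((b - ρ * x) / Real.sqrt (1 - ρ^2)))
      (nhdsWithin e (Ioo (-1) 1)) (nhds (∫ x in Iic a, L x)) := by
    refine tendsto_integral_filter_of_dominated_convergence g
      (Eventually.of_forall fun ρ => (meas ρ b).aestronglyMeasurable)
      (Eventually.of_forall fun ρ => Eventually.of_forall fun x => bnd ρ b x)
      g_int.integrableOn ?_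
    have hne : ∀ᵐ x ∂(volume.restrict (Iic a)), x ≠ e * b :=
      ae_restrict_of_ae (Measure.ae_ne volume (e * b))
    filter_upwards [hne] with x hx
    have hx' : e * x ≠ b := by
      intro h; apply hx; rcases he with rfl | rfl <;> linarith
    have hinv : Tendsto (fun ρ : ℝ => (Real.sqrt (1 - ρ^2))⁻¹) (nhdsWithin e (Ioo (-1) 1)) atTop := by
      apply Tendsto.inv_tendsto_nhdsGT_zero
      rw [tendsto_nhdsWithin_iff]
      constructor
      · have : Continuous fun ρ : ℝ => Real.sqrt (1 - ρ^2) := by fun_prop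
        have h := (this.tendsto e).mono_left (nhdsWithin_le_nhds (s := Ioo (-1) 1))
        have h0 : Real.sqrt (1 - e^2) = 0 := by rcases he with rfl | rfl <;> simp
        rwa [h0] at h
      · filter_upwards [hev] with ρ hρ
        exact Real.sqrt_pos.2 (by nlinarith [hρ.1, hρ.2])
    have hnum : Tendsto (fun ρ : ℝ => b - ρ * x) (nhdsWithin e (Ioo (-1) 1)) (nhds (b - e * x)) := by
      have : Continuous fun ρ : ℝ => b - ρ * x := by fun_prop
      exact (this.tendsto e).mono_left nhdsWithin_le_nhds
    simp only [div_eq_mul_inv]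
    rcases lt_or_gt_of_ne hx' with h | h
    · rw [hL1 x h]
      have := (cdf_top.comp (hnum.pos_mul_atTop (sub_pos.2 h) hinv)).const_mul (g x)
      rwa [mul_one] at this
    · rw [hL2 x h]
      have := (cdf_bot.comp (hnum.neg_mul_atTop (sub_neg.2 h) hinv)).const_mul (g x)
      rwa [mul_zero] at this
  refine hT.congr' ?_
  filter_upwards [hev] with ρ hρ
  exact (Phi2_eq hρ a b).symm

lemma lim_one (a b : ℝ) : Tendsto (fun ρ => Phi2 ρ a b) (nhdsWithin 1 (Ioo (-1) 1))
    (nhds (min (stdNormalCDF a) (stdNormalCDF b))) := by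
  have := lim_aux a b 1 (Or.inl rfl) ((Iic b).indicator g)
    (fun x hx => indicator_of_mem (by simp at hx; exact hx.le) g)
    (fun x hx => indicator_of_notMem (by simpa using hx) g)
  rw [setIntegral_indicator measurableSet_Iic, Iic_inter_Iic, ← cdf_eq] at this
  rwa [← cdf_mono.map_min]

lemma lim_neg_one (a b : ℝ) : Tendsto (fun ρ => Phi2 ρ a b) (nhdsWithin (-1) (Ioo (-1) 1))
    (nhds (max (stdNormalCDF a + stdNormalCDF b - 1) 0)) := by
  have := lim_aux a b (-1) (Or.inr rfl) ((Ioi (-b)).indicator g)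
    (fun x hx => indicator_of_mem (by simp only [mem_Ioi]; linarith) g)
    (fun x hx => indicator_of_notMem (by simp only [mem_Ioi]; linarith) g)
  rw [setIntegral_indicator measurableSet_Ioi, inter_comm, Ioi_inter_Iic] at this
  convert this using 2
  have hb := cdf_neg b
  rcases le_total (-b) a with h | h
  · rw [← intervalIntegral.integral_of_le h, ← cdf_sub, max_eq_left]
    · linarith
    · have := cdf_mono h; linarith
  · rw [Ioc_eq_empty (by simpa using h), max_eq_right]
    · simp
    · have := cdf_mono h; linarith

lemma ext_eq {ρ : ℝ} (hρ : ρ ∈ Ioo (-1:ℝ) 1) (a b : ℝ) : Phi2ext ρ a b = Phi2 ρ a b := by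
  unfold Phi2ext
  rw [if_neg hρ.2.ne, if_neg hρ.1.ne']

lemma ext_deriv {r : ℝ} (hr : r ∈ Ioo (-1:ℝ) 1) (a b : ℝ) :
    ∃ d > 0, HasDerivAt (fun ρ => Phi2ext ρ a b) d r := by
  obtain ⟨d, hd, h⟩ := Phi2_deriv hr a b
  refine ⟨d, hd, h.congr_of_eventuallyEq ?_⟩
  filter_upwards [Ioo_mem_nhds hr.1 hr.2] with ρ hρ
  exact ext_eq hρ a b

lemma ext_endpoint (a b e : ℝ) (he : e = 1 ∨ e = -1)
    (h : Tendsto (fun ρ => Phi2 ρ a b) (nhdsWithin e (Ioo (-1) 1)) (nhds (Phi2ext e a b))) :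
    ContinuousWithinAt (fun ρ => Phi2ext ρ a b) (Icc (-1) 1) e := by
  have h' : ContinuousWithinAt (fun ρ => Phi2ext ρ a b) (Ioo (-1) 1) e := by
    refine h.congr' ?_
    filter_upwards [self_mem_nhdsWithin] with ρ hρ
    exact (ext_eq hρ a b).symm
  have h2 := continuousWithinAt_insert_self.2 h'
  refine h2.mono_of_mem_nhdsWithin ?_
  have hn : Ioo (e - 1) (e + 1) ∈ nhds e := Ioo_mem_nhds (by linarith) (by linarith)
  filter_upwards [self_mem_nhdsWithin, mem_nhdsWithin_of_mem_nhds hn] with ρ hρ hρ2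
  by_cases hc : ρ = e
  · exact Or.inl hc
  · right
    rcases he with rfl | rfl
    · exact ⟨by linarith [hρ2.1], lt_of_le_of_ne hρ.2 hc⟩
    · exact ⟨lt_of_le_of_ne hρ.1 (Ne.symm hc), by linarith [hρ2.2]⟩

lemma ext_one (a b : ℝ) : Phi2ext 1 a b = min (stdNormalCDF a) (stdNormalCDF b) := by
  simp [Phi2ext]

lemma ext_neg_one (a b : ℝ) :
    Phi2ext (-1) a b = max (stdNormalCDF a + stdNormalCDF b - 1) 0 := by
  unfold Phi2ext
  rw [if_neg (by norm_num), if_pos rfl]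

lemma ext_cont (a b : ℝ) : ContinuousOn (fun ρ => Phi2ext ρ a b) (Icc (-1) 1) := by
  intro ρ hρ
  rcases hρ.1.eq_or_lt with h | h1
  · subst h
    exact ext_endpoint a b _ (Or.inr rfl) (by rw [ext_neg_one]; exact lim_neg_one a b)
  rcases hρ.2.eq_or_lt with h | h2
  · subst h
    exact ext_endpoint a b _ (Or.inl rfl) (by rw [ext_one]; exact lim_one a b)
  obtain ⟨d, -, h⟩ := ext_deriv ⟨h1, h2⟩ a b
  exact h.continuousAt.continuousWithinAt

lemma ext_strictMono (a b : ℝ) : StrictMonoOn (fun ρ => Phi2ext ρ a b) (Icc (-1) 1) := by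
  refine strictMonoOn_of_deriv_pos (convex_Icc _ _) (ext_cont a b) fun ρ hρ => ?_
  rw [interior_Icc] at hρ
  obtain ⟨d, hd, h⟩ := ext_deriv hρ a b
  rwa [h.deriv]

end LG

/-- every admissible copula value admits a unique local Gaussian
correlation parameter ρ ∈ [−1,1]. -/
theorem local_gaussian_representation_exists_unique
    (u₁ u₂ c : ℝ) (hu₁ : u₁ ∈ Set.Ioo (0 : ℝ) 1) (hu₂ : u₂ ∈ Set.Ioo (0 : ℝ) 1)
    (hc₁ : max (u₁ + u₂ - 1) 0 ≤ c) (hc₂ : c ≤ min u₁ u₂) :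
    ∃! ρ : ℝ, ρ ∈ Set.Icc (-1 : ℝ) 1 ∧
      Phi2ext ρ (stdNormalInv u₁) (stdNormalInv u₂) = c := by
  have hc : c ∈ Icc (Phi2ext (-1) (stdNormalInv u₁) (stdNormalInv u₂))
      (Phi2ext 1 (stdNormalInv u₁) (stdNormalInv u₂)) := by
    rw [LG.ext_one, LG.ext_neg_one, LG.cdf_inv hu₁, LG.cdf_inv hu₂]
    exact ⟨hc₁, hc₂⟩
  obtain ⟨ρ, hρ, h⟩ := intermediate_value_Icc (by norm_num : (-1:ℝ) ≤ 1)
    (LG.ext_cont (stdNormalInv u₁) (stdNormalInv u₂)) hc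
  refine ⟨ρ, ⟨hρ, h⟩, fun ρ' h' => ?_⟩
  exact (LG.ext_strictMono (stdNormalInv u₁) (stdNormalInv u₂)).injOn h'.1 hρ (h'.2.trans h.symm)
end

section
/- (Plackett's identity.) For all fixed z₁, z₂ ∈ ℝ, the map ρ ↦ Φ₂(z₁,z₂;ρ) is differentiable on (−1,1) and its derivative equals the bivariate normal density: ∂Φ₂(z₁,z₂;ρ)/∂ρ = φ₂(z₁,z₂;ρ) for every ρ ∈ (−1,1). -/
open MeasureTheory Real Set Filter

/-- Standard univariate normal density. -/
noncomputable def gd (x : ℝ) : ℝ := (Real.sqrt (2 * Real.pi))⁻¹ * Real.exp (-(x ^ 2) / 2)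

lemma gd_pos (x : ℝ) : 0 < gd x := by unfold gd; positivity

lemma gd_cont : Continuous gd := by unfold gd; fun_prop

lemma gd_int : Integrable gd := by
  have h := (integrable_exp_neg_mul_sq (b := 1/2) (by norm_num)).const_mul
    ((Real.sqrt (2 * Real.pi))⁻¹)
  refine h.congr (Eventually.of_forall fun x => ?_)
  simp only [gd]
  congr 2; ring

lemma gd_mul_int : Integrable (fun x => x * gd x) := by
  have h := (integrable_mul_exp_neg_mul_sq (b := 1/2) (by norm_num)).const_mul
    ((Real.sqrt (2 * Real.pi))⁻¹)
  refine h.congr (Eventually.of_forall fun x => ?_)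
  simp only [gd]
  rw [mul_left_comm]
  congr 3; ring

lemma gd_le (x : ℝ) : gd x ≤ 1 := by
  unfold gd
  have h1 : Real.exp (-(x ^ 2) / 2) ≤ 1 := by
    rw [Real.exp_le_one_iff]; nlinarith [sq_nonneg x]
  have h2 : (Real.sqrt (2 * Real.pi))⁻¹ ≤ 1 := by
    apply inv_le_one_of_one_le₀
    rw [Real.one_le_sqrt]; nlinarith [Real.pi_gt_three]
  exact mul_le_one₀ h2 (by positivity) h1

lemma gd_deriv (x : ℝ) : HasDerivAt gd (-x * gd x) x := by
  unfold gd
  have h : HasDerivAt (fun x : ℝ => -(x ^ 2) / 2) (-x) x := by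
    refine ((hasDerivAt_pow 2 x).neg.div_const 2).congr_deriv ?_
    push_cast; ring
  refine (h.exp.const_mul ((Real.sqrt (2 * Real.pi))⁻¹)).congr_deriv ?_
  ring

lemma gd_tendsto : Tendsto gd atBot (nhds 0) := by
  have h : Tendsto (fun x : ℝ => -(x ^ 2) / 2) atBot atBot := by
    have h2 : Tendsto (fun x : ℝ => x ^ 2) atBot atTop := by
      simpa using (tendsto_pow_atTop (two_ne_zero)).comp (tendsto_abs_atBot_atTop (G := ℝ)) |>.congr
        (fun x => by simp)
    exact (tendsto_neg_atTop_atBot.comp h2).atBot_div_const (by norm_num)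
  have := (Real.tendsto_exp_atBot.comp h).const_mul ((Real.sqrt (2 * Real.pi))⁻¹)
  rw [mul_zero] at this
  exact this

lemma cdf_eq (z : ℝ) : stdNormalCDF z = ∫ x in Set.Iic z, gd x := rfl

lemma cdf_deriv (z : ℝ) : HasDerivAt stdNormalCDF (gd z) z := by
  have h : ∀ w, stdNormalCDF w = (∫ x in (0:ℝ)..w, gd x) + stdNormalCDF 0 := by
    intro w
    rw [cdf_eq, cdf_eq, ← intervalIntegral.integral_Iic_sub_Iic gd_int.integrableOn
      gd_int.integrableOn]
    ring
  rw [funext h]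
  exact (intervalIntegral.integral_hasDerivAt_right (gd_cont.intervalIntegrable _ _)
    (gd_cont.stronglyMeasurableAtFilter _ _) gd_cont.continuousAt).add_const _

lemma cdf_cont : Continuous stdNormalCDF :=
  continuous_iff_continuousAt.2 fun z => (cdf_deriv z).continuousAt

lemma cdf_bound (z : ℝ) : ‖stdNormalCDF z‖ ≤ ∫ x, gd x := by
  rw [cdf_eq, Real.norm_of_nonneg (setIntegral_nonneg measurableSet_Iic fun x _ => (gd_pos x).le)]
  exact setIntegral_le_integral gd_int (Eventually.of_forall fun x => (gd_pos x).le)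

lemma phi2_eq (r x y : ℝ) (hr : 0 < 1 - r ^ 2) :
    phi2 r x y = gd x * gd ((y - r * x) / √(1 - r ^ 2)) / √(1 - r ^ 2) := by
  have hs : √(1 - r ^ 2) ^ 2 = 1 - r ^ 2 := Real.sq_sqrt hr.le
  have hs0 : 0 < √(1 - r ^ 2) := Real.sqrt_pos.2 hr
  have hp : √(2 * π) ^ 2 = 2 * π := Real.sq_sqrt (by positivity)
  have hp0 : 0 < √(2 * π) := Real.sqrt_pos.2 (by positivity)
  unfold phi2 gd
  have he : -(x ^ 2 - 2 * r * x * y + y ^ 2) / (2 * (1 - r ^ 2))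
      = -(x ^ 2) / 2 + -(((y - r * x) / √(1 - r ^ 2)) ^ 2) / 2 := by
    rw [div_pow, hs]
    field_simp
    ring
  rw [he, Real.exp_add]
  field_simp
  rw [hp]

lemma inner_eq (r x z : ℝ) (hr : 0 < 1 - r ^ 2) :
    ∫ y in Set.Iic z, phi2 r x y = gd x * stdNormalCDF ((z - r * x) / √(1 - r ^ 2)) := by
  have hs0 : 0 < √(1 - r ^ 2) := Real.sqrt_pos.2 hr
  set s := √(1 - r ^ 2) with hs
  have h1 : ∀ y, (Set.Iic z).indicator (fun y => phi2 r x y) y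
      = (gd x / s) * (fun w => (fun v => (Set.Iic ((z - r * x) / s)).indicator gd v) (w / s))
        (y - r * x) := by
    intro y
    have hiff : (y - r * x) / s ≤ (z - r * x) / s ↔ y ≤ z := by
      rw [div_le_div_iff_of_pos_right hs0]; constructor <;> intro h <;> linarith
    by_cases hy : y ≤ z
    · rw [Set.indicator_of_mem (by exact hy)]
      simp only []
      rw [Set.indicator_of_mem (by exact hiff.2 hy), phi2_eq r x y hr]
      ring
    · rw [Set.indicator_of_notMem (by exact hy)]
      simp only []
      rw [Set.indicator_of_notMem (by exact fun h => hy (hiff.1 h))]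
      simp
  rw [← integral_indicator measurableSet_Iic, integral_congr_ae (Eventually.of_forall h1),
    integral_const_mul, integral_sub_right_eq_self
      (fun w => (fun v => (Set.Iic ((z - r * x) / s)).indicator gd v) (w / s)) (r * x), Measure.integral_comp_div,
    integral_indicator measurableSet_Iic, cdf_eq, smul_eq_mul, abs_of_pos hs0]
  field_simp

lemma u_deriv (r x z : ℝ) (hr : 0 < 1 - r ^ 2) :
    HasDerivAt (fun r => (z - r * x) / √(1 - r ^ 2)) ((r * z - x) / √(1 - r ^ 2) ^ 3) r := by
  have hs : √(1 - r ^ 2) ^ 2 = 1 - r ^ 2 := Real.sq_sqrt hr.le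
  have hs0 : 0 < √(1 - r ^ 2) := Real.sqrt_pos.2 hr
  have h1 : HasDerivAt (fun r : ℝ => 1 - r ^ 2) (-(2 * r)) r := by
    simpa using (hasDerivAt_pow 2 r).const_sub 1
  have h2 : HasDerivAt (fun r : ℝ => z - r * x) (-x) r := by
    simpa using ((hasDerivAt_id r).mul_const x).const_sub z
  refine (h2.div (h1.sqrt hr.ne') hs0.ne').congr_deriv ?_
  field_simp
  rw [hs]
  ring

lemma phi2_deriv (r x y : ℝ) (hr : 0 < 1 - r ^ 2) :
    HasDerivAt (fun x => phi2 r x y)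
      (gd x * (gd ((y - r * x) / √(1 - r ^ 2)) * ((r * y - x) / √(1 - r ^ 2) ^ 3))) x := by
  have hs : √(1 - r ^ 2) ^ 2 = 1 - r ^ 2 := Real.sq_sqrt hr.le
  have hs0 : 0 < √(1 - r ^ 2) := Real.sqrt_pos.2 hr
  rw [funext fun x => phi2_eq r x y hr]
  have h2 : HasDerivAt (fun x : ℝ => (y - r * x) / √(1 - r ^ 2)) (-r / √(1 - r ^ 2)) x := by
    simpa using (((hasDerivAt_id x).const_mul r).const_sub y).div_const √(1 - r ^ 2)
  have h3 := ((gd_deriv x).mul ((gd_deriv _).comp x h2)).div_const √(1 - r ^ 2)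
  refine h3.congr_deriv ?_
  simp only [Function.comp_def]
  field_simp
  rw [hs]
  ring

lemma phi2_tendsto (r y : ℝ) (hr : 0 < 1 - r ^ 2) :
    Tendsto (fun x => phi2 r x y) atBot (nhds 0) := by
  have hs0 : 0 < √(1 - r ^ 2) := Real.sqrt_pos.2 hr
  rw [funext fun x => phi2_eq r x y hr]
  refine squeeze_zero (g := fun x => gd x / √(1 - r ^ 2)) (fun x => ?_) (fun x => ?_) ?_
  · have := gd_pos x
    have := gd_pos ((y - r * x) / √(1 - r ^ 2))
    positivity
  · gcongr
    exact mul_le_of_le_one_right (gd_pos x).le (gd_le _)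
  · simpa using gd_tendsto.div_const √(1 - r ^ 2)

/-- Plackett's identity: for fixed z₁, z₂, the map ρ ↦ Φ₂(z₁,z₂;ρ)
is differentiable on (−1,1) with derivative φ₂(z₁,z₂;ρ). -/
theorem plackett_identity (z₁ z₂ : ℝ) (ρ : ℝ) (hρ : ρ ∈ Set.Ioo (-1 : ℝ) 1) :
    HasDerivAt (fun r => Phi2 r z₁ z₂) (phi2 ρ z₁ z₂) ρ := by
  have hpos : 0 < 1 - ρ ^ 2 := by nlinarith [hρ.1, hρ.2]
  set c := (1 - ρ ^ 2) / 2 with hc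
  have hc0 : 0 < c := by positivity
  have hnhds : {r : ℝ | c < 1 - r ^ 2} ∈ nhds ρ := by
    apply IsOpen.mem_nhds
    · exact isOpen_lt continuous_const (by fun_prop)
    · change c < 1 - ρ ^ 2; linarith
  have hPhi : (fun r => Phi2 r z₁ z₂) =ᶠ[nhds ρ]
      fun r => ∫ x in Set.Iic z₁, gd x * stdNormalCDF ((z₂ - r * x) / √(1 - r ^ 2)) := by
    filter_upwards [hnhds] with r hr
    unfold Phi2
    have hr' : 0 < 1 - r ^ 2 := hc0.trans hr
    simp only [inner_eq r _ z₂ hr']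
  have hbi : Integrable (fun x => gd x * ((|z₂| + |x|) / √c ^ 3)) := by
    have h1 := (gd_int.const_mul |z₂|).add (gd_mul_int.abs)
    refine (h1.div_const (√c ^ 3)).congr (Eventually.of_forall fun x => ?_)
    simp only [Pi.add_apply, abs_mul, abs_of_pos (gd_pos x)]
    ring
  have hbound : ∀ x r : ℝ, r ∈ {r : ℝ | c < 1 - r ^ 2} →
      ‖gd x * (gd ((z₂ - r * x) / √(1 - r ^ 2)) * ((r * z₂ - x) / √(1 - r ^ 2) ^ 3))‖
        ≤ gd x * ((|z₂| + |x|) / √c ^ 3) := by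
    intro x r hr
    have hr' : c < 1 - r ^ 2 := hr
    have hr1 : |r| ≤ 1 := by
      rw [abs_le]; constructor <;> nlinarith
    have hsc : 0 < √c := Real.sqrt_pos.2 hc0
    have hs0 : 0 < √(1 - r ^ 2) := Real.sqrt_pos.2 (hc0.trans hr')
    rw [norm_mul, norm_mul, norm_div, Real.norm_of_nonneg (gd_pos x).le,
      Real.norm_of_nonneg (gd_pos _).le, Real.norm_of_nonneg (by positivity : 0 ≤ √(1 - r ^ 2) ^ 3)]
    refine mul_le_mul_of_nonneg_left ?_ (gd_pos x).le
    refine (mul_le_of_le_one_left (by positivity) (gd_le _)).trans ?_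
    have hn : ‖r * z₂ - x‖ ≤ |z₂| + |x| := by
      refine (norm_sub_le _ _).trans ?_
      rw [norm_mul]
      simp only [Real.norm_eq_abs]
      gcongr
      exact mul_le_of_le_one_left (abs_nonneg _) hr1
    gcongr
  have hF'cont : Continuous fun x => gd x *
      (gd ((z₂ - ρ * x) / √(1 - ρ ^ 2)) * ((ρ * z₂ - x) / √(1 - ρ ^ 2) ^ 3)) := by
    have := gd_cont
    fun_prop
  have hFcont : ∀ r : ℝ, Continuous fun x =>
      gd x * stdNormalCDF ((z₂ - r * x) / √(1 - r ^ 2)) := by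
    intro r
    have := gd_cont
    have := cdf_cont
    fun_prop
  have key := hasDerivAt_integral_of_dominated_loc_of_deriv_le
    (μ := volume.restrict (Set.Iic z₁)) (x₀ := ρ)
    (F := fun r x => gd x * stdNormalCDF ((z₂ - r * x) / √(1 - r ^ 2)))
    (F' := fun r x => gd x *
      (gd ((z₂ - r * x) / √(1 - r ^ 2)) * ((r * z₂ - x) / √(1 - r ^ 2) ^ 3)))
    (bound := fun x => gd x * ((|z₂| + |x|) / √c ^ 3))
    hnhds
    (Eventually.of_forall fun r => (hFcont r).aestronglyMeasurable)
    (by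
      refine Integrable.mono' (gd_int.mul_const (∫ x, gd x)).integrableOn
        (hFcont ρ).aestronglyMeasurable (Eventually.of_forall fun x => ?_)
      rw [norm_mul, Real.norm_of_nonneg (gd_pos x).le]
      exact mul_le_mul_of_nonneg_left (cdf_bound _) (gd_pos x).le)
    hF'cont.aestronglyMeasurable
    (Eventually.of_forall hbound)
    hbi.integrableOn
    (Eventually.of_forall fun x r hr =>
      ((cdf_deriv _).comp r (u_deriv r x z₂ (hc0.trans hr))).const_mul (gd x))
  have hint := integral_Iic_of_hasDerivAt_of_tendsto (a := z₁) (m := 0)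
    (f := fun x => phi2 ρ x z₂)
    (phi2_deriv ρ z₁ z₂ hpos).continuousAt.continuousWithinAt
    (fun x _ => phi2_deriv ρ x z₂ hpos) key.1 (phi2_tendsto ρ z₂ hpos)
  have h2 := key.2
  rw [hint, sub_zero] at h2
  exact h2.congr_of_eventuallyEq hPhi
end

section
/- For all fixed z₁, z₂ ∈ ℝ, the map ρ ↦ Φ₂(z₁,z₂;ρ) is strictly increasing on (−1,1). -/
open MeasureTheory Real Set Filter

open Topology

/-- Unnormalised Gaussian cdf. -/
noncomputable def gF (t : ℝ) : ℝ := ∫ u in Set.Iic t, Real.exp (-(u ^ 2) / 2)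

lemma gauss_int : Integrable (fun u : ℝ => Real.exp (-(u ^ 2) / 2)) := by
  have h := integrable_exp_neg_mul_sq (b := 1 / 2) (by norm_num)
  refine h.congr (Eventually.of_forall fun u => ?_)
  show Real.exp _ = Real.exp _
  congr 1; ring

lemma gauss_mul_int : Integrable (fun u : ℝ => |u| * Real.exp (-(u ^ 2) / 2)) := by
  have h := (integrable_mul_exp_neg_mul_sq (b := 1 / 2) (by norm_num)).norm
  refine h.congr (Eventually.of_forall fun u => ?_)
  show ‖_‖ = _
  rw [norm_mul, Real.norm_eq_abs, Real.norm_eq_abs, Real.abs_exp]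
  congr 2; ring

lemma gF_hasDerivAt (t : ℝ) : HasDerivAt gF (Real.exp (-(t ^ 2) / 2)) t := by
  have hc : Continuous (fun u : ℝ => Real.exp (-(u ^ 2) / 2)) := by fun_prop
  have h1 : gF = fun t => gF 0 + ∫ u in (0:ℝ)..t, Real.exp (-(u ^ 2) / 2) := by
    funext t
    rw [← intervalIntegral.integral_Iic_sub_Iic gauss_int.integrableOn gauss_int.integrableOn]
    unfold gF; ring
  rw [h1]
  exact (intervalIntegral.integral_hasDerivAt_right (hc.intervalIntegrable _ _)
    (hc.stronglyMeasurableAtFilter _ _) hc.continuousAt).const_add _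

lemma gF_continuous : Continuous gF :=
  continuous_iff_continuousAt.2 fun t => (gF_hasDerivAt t).continuousAt

lemma gF_bound (t : ℝ) : ‖gF t‖ ≤ ∫ u : ℝ, Real.exp (-(u ^ 2) / 2) := by
  unfold gF
  rw [Real.norm_of_nonneg (integral_nonneg fun u => (Real.exp_pos _).le)]
  exact setIntegral_le_integral gauss_int (Eventually.of_forall fun u => (Real.exp_pos _).le)

lemma cov (g : ℝ → ℝ) (z m s : ℝ) (hs : 0 < s) :
    ∫ y in Set.Iic z, g ((y - m) / s) = s * ∫ u in Set.Iic ((z - m) / s), g u := by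
  rw [← integral_indicator measurableSet_Iic, ← integral_indicator measurableSet_Iic]
  have h1 := integral_sub_right_eq_self (μ := volume)
    (fun y => (Set.Iic ((z - m) / s)).indicator g (y / s)) m
  have h2 := Measure.integral_comp_div ((Set.Iic ((z - m) / s)).indicator g) s
  rw [abs_of_pos hs, smul_eq_mul] at h2
  rw [← h2, ← h1]
  congr 1
  funext y
  have : y ∈ Set.Iic z ↔ (y - m) / s ∈ Set.Iic ((z - m) / s) := by
    simp only [Set.mem_Iic]
    rw [div_le_div_iff_of_pos_right hs]; simp
  by_cases hy : y ∈ Set.Iic z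
  · rw [Set.indicator_of_mem hy, Set.indicator_of_mem (this.1 hy)]
  · rw [Set.indicator_of_notMem hy, Set.indicator_of_notMem (fun h => hy (this.2 h))]

lemma one_sub_sq_pos {ρ : ℝ} (h : ρ ∈ Set.Ioo (-1 : ℝ) 1) : 0 < 1 - ρ ^ 2 := by
  nlinarith [h.1, h.2]

lemma inner_eq_s2 (ρ x z : ℝ) (h : ρ ∈ Set.Ioo (-1 : ℝ) 1) :
    ∫ y in Set.Iic z, phi2 ρ x y =
      (2 * π)⁻¹ * (Real.exp (-(x ^ 2) / 2) * gF ((z - ρ * x) / √(1 - ρ ^ 2))) := by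
  have hp := one_sub_sq_pos h
  have hs : 0 < √(1 - ρ ^ 2) := Real.sqrt_pos.2 hp
  have hsq : √(1 - ρ ^ 2) ^ 2 = 1 - ρ ^ 2 := Real.sq_sqrt hp.le
  have e : ∀ y, phi2 ρ x y = ((2 * π * √(1 - ρ ^ 2))⁻¹ * Real.exp (-(x ^ 2) / 2)) *
      (fun u : ℝ => Real.exp (-(u ^ 2) / 2)) ((y - ρ * x) / √(1 - ρ ^ 2)) := by
    intro y
    simp only [phi2]
    rw [mul_assoc _ (Real.exp _) (Real.exp _), ← Real.exp_add]
    congr 2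
    rw [div_pow, hsq]
    field_simp
    ring
  simp only [funext e]
  rw [integral_const_mul, cov (fun u : ℝ => Real.exp (-(u ^ 2) / 2)) _ _ _ hs]
  unfold gF
  field_simp

/-- The candidate derivative of the integrand. -/
noncomputable def dG (z ρ x : ℝ) : ℝ :=
  (2 * π)⁻¹ * (Real.exp (-(x ^ 2) / 2) *
    (Real.exp (-(((z - ρ * x) / √(1 - ρ ^ 2)) ^ 2) / 2) * ((ρ * z - x) / √(1 - ρ ^ 2) ^ 3)))

lemma arg_hasDerivAt (ρ x z : ℝ) (h : ρ ∈ Set.Ioo (-1 : ℝ) 1) :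
    HasDerivAt (fun ρ => (z - ρ * x) / √(1 - ρ ^ 2)) ((ρ * z - x) / √(1 - ρ ^ 2) ^ 3) ρ := by
  have hp := one_sub_sq_pos h
  have hs : 0 < √(1 - ρ ^ 2) := Real.sqrt_pos.2 hp
  have hsq : √(1 - ρ ^ 2) ^ 2 = 1 - ρ ^ 2 := Real.sq_sqrt hp.le
  have h1 : HasDerivAt (fun ρ : ℝ => 1 - ρ ^ 2) (-(2 * ρ)) ρ := by
    simpa using (hasDerivAt_pow 2 ρ).const_sub 1
  have h2 := h1.sqrt hp.ne'
  have h3 : HasDerivAt (fun ρ : ℝ => z - ρ * x) (-x) ρ := by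
    simpa using ((hasDerivAt_id ρ).mul_const x).const_sub z
  refine (h3.div h2 hs.ne').congr_deriv ?_
  generalize √(1 - ρ ^ 2) = s at *
  field_simp
  rw [hsq]
  ring

lemma integrand_hasDerivAt (ρ x z : ℝ) (h : ρ ∈ Set.Ioo (-1 : ℝ) 1) :
    HasDerivAt (fun ρ => (2 * π)⁻¹ * (Real.exp (-(x ^ 2) / 2) *
      gF ((z - ρ * x) / √(1 - ρ ^ 2)))) (dG z ρ x) ρ := by
  have := (gF_hasDerivAt ((z - ρ * x) / √(1 - ρ ^ 2))).comp ρ (arg_hasDerivAt ρ x z h)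
  exact (this.const_mul _).const_mul _

lemma dG_bound (z ρ x r : ℝ) (hr : r < 1) (h : ρ ∈ Set.Ioo (-r) r) :
    ‖dG z ρ x‖ ≤ (2 * π)⁻¹ * (√(1 - r ^ 2) ^ 3)⁻¹ *
      (|z| * Real.exp (-(x ^ 2) / 2) + |x| * Real.exp (-(x ^ 2) / 2)) := by
  have h0 : 0 < 1 - r ^ 2 := by nlinarith [h.1, h.2]
  have hs0 : 0 < √(1 - r ^ 2) := Real.sqrt_pos.2 h0
  have hle : √(1 - r ^ 2) ≤ √(1 - ρ ^ 2) := Real.sqrt_le_sqrt (by nlinarith [h.1, h.2])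
  have hs := hs0.trans_le hle
  have hρ : |ρ| ≤ 1 := abs_le.2 ⟨by linarith [h.1], by linarith [h.2]⟩
  have hnum : |ρ * z - x| ≤ |z| + |x| := by
    refine (abs_sub _ _).trans ?_
    rw [abs_mul]
    nlinarith [abs_nonneg z]
  unfold dG
  rw [norm_mul, norm_mul, norm_mul, norm_div]
  simp only [Real.norm_eq_abs, Real.abs_exp]
  rw [abs_of_pos (by positivity : 0 < (2 * π)⁻¹), abs_of_pos (pow_pos hs 3)]
  have h1 : Real.exp (-(((z - ρ * x) / √(1 - ρ ^ 2)) ^ 2) / 2) ≤ 1 := by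
    rw [Real.exp_le_one_iff]
    have := sq_nonneg ((z - ρ * x) / √(1 - ρ ^ 2))
    linarith
  have h2 : |ρ * z - x| / √(1 - ρ ^ 2) ^ 3 ≤ (|z| + |x|) / √(1 - r ^ 2) ^ 3 := by
    gcongr
  calc _ ≤ (2 * π)⁻¹ * (Real.exp (-(x ^ 2) / 2) * (1 * ((|z| + |x|) / √(1 - r ^ 2) ^ 3))) := by
        gcongr
    _ = _ := by field_simp

lemma phi2_hasDerivAt_x (z ρ x : ℝ) (h : ρ ∈ Set.Ioo (-1 : ℝ) 1) :
    HasDerivAt (fun x => phi2 ρ x z) (dG z ρ x) x := by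
  have hp := one_sub_sq_pos h
  have hs : 0 < √(1 - ρ ^ 2) := Real.sqrt_pos.2 hp
  have hsq : √(1 - ρ ^ 2) ^ 2 = 1 - ρ ^ 2 := Real.sq_sqrt hp.le
  have h1 : HasDerivAt (fun x : ℝ => -(x ^ 2 - 2 * ρ * x * z + z ^ 2) / (2 * (1 - ρ ^ 2)))
      (-(2 * x - 2 * ρ * z) / (2 * (1 - ρ ^ 2))) x := by
    have a := hasDerivAt_pow 2 x
    have b := ((hasDerivAt_id x).const_mul (2 * ρ)).mul_const z
    have := (((a.sub b).add_const (z ^ 2)).neg).div_const (2 * (1 - ρ ^ 2))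
    refine this.congr_deriv ?_
    simp
  have h2 := h1.exp.const_mul (2 * π * √(1 - ρ ^ 2))⁻¹
  refine h2.congr_deriv ?_
  unfold dG
  have he : Real.exp (-(x ^ 2 - 2 * ρ * x * z + z ^ 2) / (2 * (1 - ρ ^ 2))) =
      Real.exp (-(x ^ 2) / 2) * Real.exp (-(((z - ρ * x) / √(1 - ρ ^ 2)) ^ 2) / 2) := by
    rw [← Real.exp_add]
    congr 1
    rw [div_pow, hsq]
    field_simp
    ring
  rw [he]
  have h3 : √(1 - ρ ^ 2) ^ 3 = √(1 - ρ ^ 2) * (1 - ρ ^ 2) := by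
    rw [pow_succ, hsq]; ring
  rw [h3]
  field_simp
  ring

lemma phi2_tendsto_s2 (z ρ : ℝ) (h : ρ ∈ Set.Ioo (-1 : ℝ) 1) :
    Tendsto (fun x => phi2 ρ x z) atBot (𝓝 0) := by
  have hp := one_sub_sq_pos h
  have h1 : Tendsto (fun x : ℝ => x + -(ρ * z)) atBot atBot :=
    tendsto_atBot_add_const_right _ _ tendsto_id
  have h2 : Tendsto (fun x : ℝ => (x + -(ρ * z)) * (x + -(ρ * z))) atBot atTop :=
    h1.atBot_mul_atBot₀ h1
  have h3 := (tendsto_atTop_add_const_right _ (z ^ 2 * (1 - ρ ^ 2)) h2).atTop_div_const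
    (by positivity : 0 < 2 * (1 - ρ ^ 2))
  have h4 := (Real.tendsto_exp_neg_atTop_nhds_zero.comp h3).const_mul (2 * π * √(1 - ρ ^ 2))⁻¹
  rw [mul_zero] at h4
  refine h4.congr fun x => ?_
  simp only [phi2, Function.comp]
  congr 2
  ring

lemma Phi2_hasDerivAt (z₁ z₂ ρ : ℝ) (h : ρ ∈ Set.Ioo (-1 : ℝ) 1) :
    HasDerivAt (fun ρ => Phi2 ρ z₁ z₂) (phi2 ρ z₁ z₂) ρ := by
  obtain ⟨r, hr0, hr1⟩ := exists_between (abs_lt.2 h)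
  have hmem : ρ ∈ Set.Ioo (-r) r := abs_lt.1 hr0
  have hsub : Set.Ioo (-r) r ⊆ Set.Ioo (-1 : ℝ) 1 := fun a ha =>
    ⟨by linarith [ha.1], by linarith [ha.2]⟩
  have hcont : ∀ ρ : ℝ, Continuous (fun x => (2 * π)⁻¹ * (Real.exp (-(x ^ 2) / 2) *
      gF ((z₂ - ρ * x) / √(1 - ρ ^ 2)))) := by
    intro ρ
    have := gF_continuous
    fun_prop
  have hint : Integrable (fun x => (2 * π)⁻¹ * (Real.exp (-(x ^ 2) / 2) *
      gF ((z₂ - ρ * x) / √(1 - ρ ^ 2)))) := by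
    refine Integrable.const_mul ?_ _
    have hc : Continuous fun x => gF ((z₂ - ρ * x) / √(1 - ρ ^ 2)) := by
      have := gF_continuous
      fun_prop
    exact gauss_int.mul_bdd hc.aestronglyMeasurable
      (Eventually.of_forall fun x => gF_bound _)
  have key := hasDerivAt_integral_of_dominated_loc_of_deriv_le
    (μ := volume.restrict (Set.Iic z₁)) (x₀ := ρ) (s := Set.Ioo (-r) r)
    (F := fun ρ x => (2 * π)⁻¹ * (Real.exp (-(x ^ 2) / 2) *
      gF ((z₂ - ρ * x) / √(1 - ρ ^ 2)))) (F' := dG z₂)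
    (bound := fun x => (2 * π)⁻¹ * (√(1 - r ^ 2) ^ 3)⁻¹ *
      (|z₂| * Real.exp (-(x ^ 2) / 2) + |x| * Real.exp (-(x ^ 2) / 2)))
    (isOpen_Ioo.mem_nhds hmem)
    (Eventually.of_forall fun ρ => (hcont ρ).aestronglyMeasurable)
    hint.integrableOn
    (by
      refine Continuous.aestronglyMeasurable ?_
      unfold dG
      fun_prop)
    (Eventually.of_forall fun x ρ' hρ' => dG_bound z₂ ρ' x r hr1 hρ')
    (((gauss_int.const_mul _).add gauss_mul_int).const_mul _).integrableOn
    (Eventually.of_forall fun x ρ' hρ' => integrand_hasDerivAt ρ' x z₂ (hsub hρ'))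
  obtain ⟨hi, hd⟩ := key
  have hv : ∫ x in Set.Iic z₁, dG z₂ ρ x = phi2 ρ z₁ z₂ := by
    have := integral_Iic_of_hasDerivAt_of_tendsto' (a := z₁)
      (fun x _ => phi2_hasDerivAt_x z₂ ρ x h) hi (phi2_tendsto_s2 z₂ ρ h)
    rw [this, sub_zero]
  rw [hv] at hd
  refine hd.congr_of_eventuallyEq ?_
  filter_upwards [isOpen_Ioo.mem_nhds h] with a ha
  unfold Phi2
  simp_rw [inner_eq_s2 a _ z₂ ha]

/-- for fixed z₁, z₂, the map ρ ↦ Φ₂(z₁,z₂;ρ) is strictly increasing on (−1,1). -/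
theorem Phi2_strictMonoOn_correlation (z₁ z₂ : ℝ) :
    StrictMonoOn (fun ρ => Phi2 ρ z₁ z₂) (Set.Ioo (-1 : ℝ) 1) := by
  refine strictMonoOn_of_deriv_pos (convex_Ioo _ _)
    (fun ρ h => (Phi2_hasDerivAt z₁ z₂ ρ h).continuousAt.continuousWithinAt) fun ρ h => ?_
  rw [interior_Ioo] at h
  rw [(Phi2_hasDerivAt z₁ z₂ ρ h).deriv]
  have hs : 0 < √(1 - ρ ^ 2) := Real.sqrt_pos.2 (one_sub_sq_pos h)
  unfold phi2
  positivity
end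

section
/- (Hadamard differentiability of the sequential rank map; Lemma B.1.) Suppose (g_n, κ_n) → (g, κ) uniformly on E with (g, κ) ∈ 𝒯₀*, and suppose (G_{0,n} + n^{−1/2} g_n, K_{0,n} + n^{−1/2} κ_n) ∈ 𝒜_n for every n. Then sup_{(u,s,h)∈E} | Υ_n(g_n, κ_n)(u,s,h) − ( g(u,s,h) − μ Σ_{p=1,2} ∂_p C(u) κ(u⁽ᵖ⁾, s, h) ) | → 0 as n → ∞. -/
open MeasureTheory Real Set Filter

/-- The scaled time fraction s_n = ⌊sn⌋/n. -/
noncomputable def timeFrac (n : ℕ) (s : ℝ) : ℝ := (⌊s * (n : ℝ)⌋₊ : ℝ) / n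

/-- The scaled generalized inverse in_n(K_p)(x,s,h) = inf{y ∈ [0,1] : K_p(y,s,h) ≥ s_n·x},
with the convention in_n(K_p)(x,0,h) = 0. -/
noncomputable def genInv {d : ℕ} (n : ℕ) (Kp : ℝ → ℝ → (Fin d → ℝ) → ℝ)
    (x s : ℝ) (h : Fin d → ℝ) : ℝ :=
  if s = 0 then 0
  else sInf {y : ℝ | y ∈ Set.Icc (0 : ℝ) 1 ∧ timeFrac n s * x ≤ Kp y s h}

/-- The sequential rank map Φ_n(G,K)(u,s,h) = G(in_n(K₁)(u₁,s,h), in_n(K₂)(u₂,s,h), s, h),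
with the convention Φ_n(G,K)(u,0,h) = 0. -/
noncomputable def rankMap {k d : ℕ} (n : ℕ)
    (G : ℝ × ℝ → ℝ → (Fin d → ℝ) → Fin k → ℝ)
    (K : ℝ × ℝ → ℝ → (Fin d → ℝ) → ℝ)
    (u : ℝ × ℝ) (s : ℝ) (h : Fin d → ℝ) : Fin k → ℝ :=
  if s = 0 then 0
  else G (genInv n (fun x s' h' => K (x, 1) s' h') u.1 s h,
          genInv n (fun x s' h' => K (1, x) s' h') u.2 s h) s h

/-- Membership in the domain 𝒜_n: G is bounded (ℝᵏ-valued) on E, K is bounded on E, and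
for every (s,h) ∈ [0,1] × H the section u ↦ K(u,s,h) is a bivariate cdf on [0,1]² with
total mass s_n (2-increasing, grounded, mass s_n at (1,1); its margins then automatically
satisfy K_p(0,s,h) = 0 and K_p(1,s,h) = s_n). -/
def memDomainAn {k d : ℕ} (n : ℕ) (H : Set (Fin d → ℝ))
    (G : ℝ × ℝ → ℝ → (Fin d → ℝ) → Fin k → ℝ)
    (K : ℝ × ℝ → ℝ → (Fin d → ℝ) → ℝ) : Prop :=
  (∃ M : ℝ, ∀ u : ℝ × ℝ, ∀ s ∈ Set.Icc (0 : ℝ) 1, ∀ h ∈ H,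
      u.1 ∈ Set.Icc (0 : ℝ) 1 → u.2 ∈ Set.Icc (0 : ℝ) 1 → ∀ i, |G u s h i| ≤ M) ∧
  (∃ M : ℝ, ∀ u : ℝ × ℝ, ∀ s ∈ Set.Icc (0 : ℝ) 1, ∀ h ∈ H,
      u.1 ∈ Set.Icc (0 : ℝ) 1 → u.2 ∈ Set.Icc (0 : ℝ) 1 → |K u s h| ≤ M) ∧
  (∀ s ∈ Set.Icc (0 : ℝ) 1, ∀ h ∈ H,
    (∀ a₁ b₁ a₂ b₂ : ℝ, 0 ≤ a₁ → a₁ ≤ b₁ → b₁ ≤ 1 → 0 ≤ a₂ → a₂ ≤ b₂ → b₂ ≤ 1 →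
      0 ≤ K (b₁, b₂) s h - K (a₁, b₂) s h - K (b₁, a₂) s h + K (a₁, a₂) s h) ∧
    (∀ x ∈ Set.Icc (0 : ℝ) 1, K (x, 0) s h = 0 ∧ K (0, x) s h = 0) ∧
    K (1, 1) s h = timeFrac n s)

/-- One-dimensional generalized inverse estimate. -/
lemma aux_inv (φ ψ : ℝ → ℝ) (a r ε x : ℝ) (hφ : ContinuousOn φ (Set.Icc 0 1)) (hφ0 : φ 0 = 0)
    (hψ : ∀ y ∈ Set.Icc (0:ℝ) 1, |ψ y - φ y| ≤ ε) (ha : 0 ≤ a) (hr : 0 ≤ r)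
    (hx : x ∈ Set.Icc (0:ℝ) 1) (h1 : a * 1 + r * ψ 1 = a) :
    sInf {y : ℝ | y ∈ Set.Icc (0:ℝ) 1 ∧ a * x ≤ a * y + r * ψ y} ∈ Set.Icc (0:ℝ) 1 ∧
    |a * (sInf {y : ℝ | y ∈ Set.Icc (0:ℝ) 1 ∧ a * x ≤ a * y + r * ψ y} - x) +
      r * φ (sInf {y : ℝ | y ∈ Set.Icc (0:ℝ) 1 ∧ a * x ≤ a * y + r * ψ y})| ≤ r * ε := by
  set S := {y : ℝ | y ∈ Set.Icc (0:ℝ) 1 ∧ a * x ≤ a * y + r * ψ y} with hS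
  have h1S : (1:ℝ) ∈ S := by
    refine ⟨by simp, ?_⟩
    rw [h1]; exact mul_le_of_le_one_right ha hx.2
  have hSI : S ⊆ Set.Icc 0 1 := fun y hy => hy.1
  have hbdd : BddBelow S := ⟨0, fun y hy => hy.1.1⟩
  have hcl : sInf S ∈ closure S := csInf_mem_closure ⟨1, h1S⟩ hbdd
  have hI : sInf S ∈ Set.Icc (0:ℝ) 1 := by
    have := closure_mono hSI hcl
    rwa [isClosed_Icc.closure_eq] at this
  set z := sInf S with hz
  have hf : ContinuousOn (fun y => a * y + r * φ y) (Set.Icc 0 1) :=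
    (continuousOn_const.mul continuousOn_id).add (continuousOn_const.mul hφ)
  have hε : ∀ y ∈ Set.Icc (0:ℝ) 1, r * ψ y ≤ r * φ y + r * ε ∧ r * φ y - r * ε ≤ r * ψ y := by
    intro y hy
    have := abs_le.1 (hψ y hy)
    constructor
    · rw [← mul_add]; exact mul_le_mul_of_nonneg_left (by linarith) hr
    · rw [← mul_sub]; exact mul_le_mul_of_nonneg_left (by linarith) hr
  have hfz : ContinuousWithinAt (fun y => a * y + r * φ y) (Set.Icc 0 1) z := hf z hI
  refine ⟨hI, abs_le.2 ⟨?_, ?_⟩⟩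
  · have : a * x - r * ε ≤ a * z + r * φ z := by
      have := mem_closure_iff_nhdsWithin_neBot.1 hcl
      refine ge_of_tendsto (hfz.mono hSI) ?_
      filter_upwards [self_mem_nhdsWithin] with y hy
      have := (hε y hy.1).1
      have := hy.2
      linarith
    linarith
  · have : a * z + r * φ z ≤ a * x + r * ε := by
      rcases eq_or_lt_of_le hI.1 with h0 | h0
      · rw [← h0, hφ0]
        have h2 := (abs_nonneg _).trans (hψ 0 (by simp))
        have := mul_nonneg hr h2
        have := mul_nonneg ha hx.1
        linarith
      · have hsub : Set.Ico 0 z ⊆ Set.Icc (0:ℝ) 1 := fun y hy => ⟨hy.1, hy.2.le.trans hI.2⟩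
        have hcl2 : z ∈ closure (Set.Ico 0 z) := by
          rw [closure_Ico h0.ne]; exact ⟨h0.le, le_rfl⟩
        have := mem_closure_iff_nhdsWithin_neBot.1 hcl2
        refine le_of_tendsto (hfz.mono hsub) ?_
        filter_upwards [self_mem_nhdsWithin] with y hy
        have h3 : y ∉ S := fun h => absurd (csInf_le hbdd h) (not_le.2 hy.2)
        have h4 : ¬ (a * x ≤ a * y + r * ψ y) := fun h => h3 ⟨hsub hy, h⟩
        have := (hε y (hsub hy)).2
        linarith
    linarith

lemma aux_uc {X : Type*} [PseudoMetricSpace X] {f : X → ℝ} {E : Set X} (hE : IsCompact E)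
    (hf : ContinuousOn f E) (η : ℝ) (hη : 0 < η) :
    ∃ δ > 0, ∀ x ∈ E, ∀ y ∈ E, dist x y < δ → |f x - f y| < η := by
  have := Metric.uniformContinuousOn_iff.1 (hE.uniformContinuousOn_of_continuous hf) η hη
  simpa [Real.dist_eq] using this

lemma aux_D (F D : ℝ × ℝ → ℝ)
    (hLip : ∀ a ∈ Set.Icc (0:ℝ) 1, ∀ a' ∈ Set.Icc (0:ℝ) 1, ∀ b ∈ Set.Icc (0:ℝ) 1,
      |F (a, b) - F (a', b)| ≤ |a - a'|)
    (u : ℝ × ℝ) (h1 : u.1 ∈ Set.Ioo (0 : ℝ) 1) (h2 : u.2 ∈ Set.Icc (0 : ℝ) 1)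
    (hD : HasDerivAt (fun x => F (x, u.2)) (D u) u.1) : |D u| ≤ 1 := by
  have := hD.le_of_lip' (C := 1) zero_le_one (by
    filter_upwards [Ioo_mem_nhds h1.1 h1.2] with x hx
    simpa using hLip x (Ioo_subset_Icc_self hx) u.1 (Ioo_subset_Icc_self h1) u.2 h2)
  simpa using this

lemma aux_bdry (F D : ℝ × ℝ → ℝ)
    (hLip : ∀ a ∈ Set.Icc (0:ℝ) 1, ∀ a' ∈ Set.Icc (0:ℝ) 1, ∀ b ∈ Set.Icc (0:ℝ) 1,
      |F (a, b) - F (a', b)| ≤ |a - a'|)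
    (hD : ∀ u : ℝ × ℝ, u.1 ∈ Set.Ioo (0 : ℝ) 1 → u.2 ∈ Set.Icc (0 : ℝ) 1 →
      HasDerivAt (fun x => F (x, u.2)) (D u) u.1)
    (η B : ℝ) (hη : 0 < η) (hB : 0 ≤ B) (u₁ u₂ v₁ v₂ : ℝ) (hu₁ : u₁ ∈ Set.Icc (0:ℝ) 1)
    (hu₂ : u₂ ∈ Set.Icc (0:ℝ) 1) (hv₁ : v₁ ∈ Set.Icc (0:ℝ) 1)
    (hv₂ : v₂ ∈ Set.Icc (0:ℝ) 1) (A c : ℝ)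
    (hcb : u₁ = 0 ∨ u₁ = 1 → c = 0)
    (h2 : |A * (v₁ - u₁)| ≤ 3 * η) (hc : |c| ≤ η) :
    |A * (F (v₁, v₂) - F (u₁, v₂)) + D (u₁, u₂) * c| ≤ (B + 4) * η := by
  have hBη : 0 ≤ B * η := by positivity
  have hDc : |D (u₁, u₂) * c| ≤ η := by
    by_cases hb : u₁ = 0 ∨ u₁ = 1
    · rw [hcb hb]; simpa using hη.le
    · push Not at hb
      have hI : u₁ ∈ Set.Ioo (0:ℝ) 1 :=
        ⟨lt_of_le_of_ne hu₁.1 (Ne.symm hb.1), lt_of_le_of_ne hu₁.2 hb.2⟩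
      have := aux_D F D hLip (u₁, u₂) hI hu₂ (hD _ hI hu₂)
      rw [abs_mul]
      nlinarith [abs_nonneg c]
  have h1 : |A * (F (v₁, v₂) - F (u₁, v₂))| ≤ |A * (v₁ - u₁)| := by
    rw [abs_mul, abs_mul]
    exact mul_le_mul_of_nonneg_left (hLip _ hv₁ _ hu₁ _ hv₂) (abs_nonneg _)
  have := abs_add_le (A * (F (v₁, v₂) - F (u₁, v₂))) (D (u₁, u₂) * c)
  linarith

/-- Key one-coordinate differentiation estimate. -/
lemma aux_coord (F D : ℝ × ℝ → ℝ)
    (hLip : ∀ a ∈ Set.Icc (0:ℝ) 1, ∀ a' ∈ Set.Icc (0:ℝ) 1, ∀ b ∈ Set.Icc (0:ℝ) 1,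
      |F (a, b) - F (a', b)| ≤ |a - a'|)
    (hD : ∀ u : ℝ × ℝ, u.1 ∈ Set.Ioo (0 : ℝ) 1 → u.2 ∈ Set.Icc (0 : ℝ) 1 →
      HasDerivAt (fun x => F (x, u.2)) (D u) u.1)
    (hDcont : ContinuousOn D
      {u : ℝ × ℝ | u.1 ∈ Set.Ioo (0 : ℝ) 1 ∧ u.2 ∈ Set.Icc (0 : ℝ) 1})
    (η δ₁ B : ℝ) (hη : 0 < η) (hδ₁ : 0 < δ₁) :
    ∃ δ > 0, ∀ u₁ ∈ Set.Icc (0:ℝ) 1, ∀ u₂ ∈ Set.Icc (0:ℝ) 1, ∀ v₁ ∈ Set.Icc (0:ℝ) 1,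
      ∀ v₂ ∈ Set.Icc (0:ℝ) 1, ∀ A c : ℝ, 0 ≤ A → |v₁ - u₁| < δ → |v₂ - u₂| < δ → |c| ≤ B →
      (u₁ < δ₁ → |c| ≤ η) → (1 - δ₁ < u₁ → |c| ≤ η) → (u₁ = 0 ∨ u₁ = 1 → c = 0) →
      |A * (v₁ - u₁) + c| ≤ 2 * η →
      |A * (F (v₁, v₂) - F (u₁, v₂)) + D (u₁, u₂) * c| ≤ (B + 4) * η := by
  have hK : IsCompact (Set.Icc (δ₁/2) (1 - δ₁/2) ×ˢ Set.Icc (0:ℝ) 1) :=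
    isCompact_Icc.prod isCompact_Icc
  obtain ⟨δ, hδ, hu⟩ := aux_uc hK (hDcont.mono (by
    rintro ⟨a, b⟩ ⟨ha, hb⟩
    simp only [Set.mem_Icc] at ha
    exact ⟨⟨by linarith, by linarith⟩, hb⟩)) η hη
  refine ⟨min δ (δ₁/2), by positivity, ?_⟩
  intro u₁ hu₁ u₂ hu₂ v₁ hv₁ v₂ hv₂ A c hA hd1 hd2 hcB hc0 hc1 hcb hAc
  have hB : 0 ≤ B := (abs_nonneg c).trans hcB
  have hBη : 0 ≤ B * η := by positivity
  have bdry : |c| ≤ η → |A * (F (v₁, v₂) - F (u₁, v₂)) + D (u₁, u₂) * c| ≤ (B + 4) * η :=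
    fun hc => by
      refine aux_bdry F D hLip hD η B hη hB u₁ u₂ v₁ v₂ hu₁ hu₂ hv₁ hv₂ A c hcb ?_ hc
      have := abs_sub (A * (v₁ - u₁) + c) c
      rw [add_sub_cancel_right] at this
      linarith
  by_cases hb0 : u₁ < δ₁
  · exact bdry (hc0 hb0)
  by_cases hb1 : 1 - δ₁ < u₁
  · exact bdry (hc1 hb1)
  push Not at hb0 hb1
  have hd1' : |v₁ - u₁| < δ₁/2 := hd1.trans_le (min_le_right _ _)
  obtain ⟨hd1a, hd1b⟩ := abs_lt.1 hd1'
  have hseg : ∀ x ∈ Set.uIcc u₁ v₁, x ∈ Set.Icc (δ₁/2) (1 - δ₁/2) ∧ |x - u₁| ≤ |v₁ - u₁| := by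
    intro x hx
    refine ⟨?_, Set.abs_sub_left_of_mem_uIcc hx⟩
    have : x ∈ Set.Icc (δ₁/2) (1 - δ₁/2) := by
      refine (Set.uIcc_subset_Icc ?_ ?_) hx <;> constructor <;> linarith
    exact this
  -- mean value theorem
  obtain ⟨ξ, hξ, hmv⟩ : ∃ ξ ∈ Set.uIcc u₁ v₁, F (v₁, v₂) - F (u₁, v₂) = D (ξ, v₂) * (v₁ - u₁) := by
    have hder : ∀ x ∈ Set.uIcc u₁ v₁, HasDerivAt (fun x => F (x, v₂)) (D (x, v₂)) x := by
      intro x hx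
      have := (hseg x hx).1
      exact hD (x, v₂) ⟨by linarith [this.1], by linarith [this.2]⟩ hv₂
    rcases lt_trichotomy u₁ v₁ with h | h | h
    · rw [Set.uIcc_of_le h.le] at hder ⊢
      obtain ⟨ξ, hξ, he⟩ := exists_hasDerivAt_eq_slope (fun x => F (x, v₂)) (fun x => D (x, v₂)) h
        (fun x hx => (hder x hx).continuousAt.continuousWithinAt)
        (fun x hx => hder x (Ioo_subset_Icc_self hx))
      refine ⟨ξ, Ioo_subset_Icc_self hξ, ?_⟩
      have : v₁ - u₁ ≠ 0 := by linarith
      rw [he]; field_simp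
    · subst h; exact ⟨u₁, by simp, by simp⟩
    · rw [Set.uIcc_of_ge h.le] at hder ⊢
      obtain ⟨ξ, hξ, he⟩ := exists_hasDerivAt_eq_slope (fun x => F (x, v₂)) (fun x => D (x, v₂)) h
        (fun x hx => (hder x hx).continuousAt.continuousWithinAt)
        (fun x hx => hder x (Ioo_subset_Icc_self hx))
      refine ⟨ξ, Ioo_subset_Icc_self hξ, ?_⟩
      have : u₁ - v₁ ≠ 0 := by linarith
      rw [he]; field_simp; ring
  obtain ⟨hξI, hξd⟩ := hseg ξ hξ
  have hD1 : |D (ξ, v₂)| ≤ 1 := by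
    have hI : ξ ∈ Set.Ioo (0:ℝ) 1 := ⟨by linarith [hξI.1], by linarith [hξI.2]⟩
    exact aux_D F D hLip (ξ, v₂) hI hv₂ (hD _ hI hv₂)
  have hDD : |D (u₁, u₂) - D (ξ, v₂)| < η := by
    refine hu _ ⟨⟨by simp; linarith, by simp; linarith⟩, hu₂⟩ _ ⟨hξI, hv₂⟩ ?_
    rw [Prod.dist_eq, Real.dist_eq, Real.dist_eq, abs_sub_comm, abs_sub_comm u₂]
    exact max_lt ((hξd.trans_lt hd1).trans_le (min_le_left _ _)) (hd2.trans_le (min_le_left _ _))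
  have heq : A * (F (v₁, v₂) - F (u₁, v₂)) + D (u₁, u₂) * c =
      D (ξ, v₂) * (A * (v₁ - u₁) + c) + (D (u₁, u₂) - D (ξ, v₂)) * c := by
    rw [hmv]; ring
  rw [heq]
  refine (abs_add_le _ _).trans ?_
  rw [abs_mul, abs_mul]
  have e1 : |D (ξ, v₂)| * |A * (v₁ - u₁) + c| ≤ 1 * (2 * η) :=
    mul_le_mul hD1 hAc (abs_nonneg _) zero_le_one
  have e2 : |D (u₁, u₂) - D (ξ, v₂)| * |c| ≤ η * B :=
    mul_le_mul hDD.le hcB (abs_nonneg _) hη.le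
  linarith

/-- Hadamard differentiability of the sequential rank map, Lemma B.1:
if (g_n, κ_n) → (g, κ) uniformly on E = [0,1]² × [0,1] × H with (g, κ) in the tangent set
𝒯₀* (continuous on E and vanishing as prescribed on the boundary), and the perturbed pairs
(G_{0,n} + n^{−1/2} g_n, K_{0,n} + n^{−1/2} κ_n) lie in 𝒜_n, then
Υ_n(g_n, κ_n) → g(u,s,h) − μ Σ_{p=1,2} ∂_p C(u) κ(u⁽ᵖ⁾,s,h) uniformly on E, where
Υ_n(g,κ) := √n (Φ_n(G_{0,n} + n^{−1/2} g, K_{0,n} + n^{−1/2} κ) − Φ_n(G_{0,n}, K_{0,n})),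
G_{0,n}(u,s,h) := s_n μ C(u) and K_{0,n}(u,s,h) := s_n C(u). -/
theorem hadamard_differentiability_sequential_rank_map
    (k d : ℕ) (μv : Fin k → ℝ) (H : Set (Fin d → ℝ)) (hH : IsCompact H)
    (C D₁ D₂ : ℝ × ℝ → ℝ)
    -- C is a bivariate copula …
    (hCground : ∀ x ∈ Set.Icc (0 : ℝ) 1, C (x, 0) = 0 ∧ C (0, x) = 0)
    (hCmarg : ∀ x ∈ Set.Icc (0 : ℝ) 1, C (x, 1) = x ∧ C (1, x) = x)
    (hCinc : ∀ a₁ b₁ a₂ b₂ : ℝ, 0 ≤ a₁ → a₁ ≤ b₁ → b₁ ≤ 1 → 0 ≤ a₂ → a₂ ≤ b₂ → b₂ ≤ 1 →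
      0 ≤ C (b₁, b₂) - C (a₁, b₂) - C (b₁, a₂) + C (a₁, a₂))
    -- … whose partial derivatives ∂₁C = D₁ and ∂₂C = D₂ exist and are continuous on
    -- {u ∈ [0,1]² : uᵢ ∈ (0,1)}
    (hD₁ : ∀ u : ℝ × ℝ, u.1 ∈ Set.Ioo (0 : ℝ) 1 → u.2 ∈ Set.Icc (0 : ℝ) 1 →
      HasDerivAt (fun x => C (x, u.2)) (D₁ u) u.1)
    (hD₁cont : ContinuousOn D₁
      {u : ℝ × ℝ | u.1 ∈ Set.Ioo (0 : ℝ) 1 ∧ u.2 ∈ Set.Icc (0 : ℝ) 1})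
    (hD₂ : ∀ u : ℝ × ℝ, u.2 ∈ Set.Ioo (0 : ℝ) 1 → u.1 ∈ Set.Icc (0 : ℝ) 1 →
      HasDerivAt (fun y => C (u.1, y)) (D₂ u) u.2)
    (hD₂cont : ContinuousOn D₂
      {u : ℝ × ℝ | u.2 ∈ Set.Ioo (0 : ℝ) 1 ∧ u.1 ∈ Set.Icc (0 : ℝ) 1})
    -- the perturbation sequences and their limits
    (g : ℕ → ℝ × ℝ → ℝ → (Fin d → ℝ) → Fin k → ℝ)
    (κ : ℕ → ℝ × ℝ → ℝ → (Fin d → ℝ) → ℝ)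
    (gl : ℝ × ℝ → ℝ → (Fin d → ℝ) → Fin k → ℝ)
    (κl : ℝ × ℝ → ℝ → (Fin d → ℝ) → ℝ)
    -- (gl, κl) ∈ 𝒯₀*: continuity on E …
    (hglcont : ∀ i : Fin k, ContinuousOn
      (fun x : (ℝ × ℝ) × ℝ × (Fin d → ℝ) => gl x.1 x.2.1 x.2.2 i)
      {x : (ℝ × ℝ) × ℝ × (Fin d → ℝ) | x.1.1 ∈ Set.Icc (0 : ℝ) 1 ∧
        x.1.2 ∈ Set.Icc (0 : ℝ) 1 ∧ x.2.1 ∈ Set.Icc (0 : ℝ) 1 ∧ x.2.2 ∈ H})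
    (hκlcont : ContinuousOn
      (fun x : (ℝ × ℝ) × ℝ × (Fin d → ℝ) => κl x.1 x.2.1 x.2.2)
      {x : (ℝ × ℝ) × ℝ × (Fin d → ℝ) | x.1.1 ∈ Set.Icc (0 : ℝ) 1 ∧
        x.1.2 ∈ Set.Icc (0 : ℝ) 1 ∧ x.2.1 ∈ Set.Icc (0 : ℝ) 1 ∧ x.2.2 ∈ H})
    -- … and boundary conditions
    (hglbd : ∀ u : ℝ × ℝ, ∀ s ∈ Set.Icc (0 : ℝ) 1, ∀ h ∈ H,
      u.1 ∈ Set.Icc (0 : ℝ) 1 → u.2 ∈ Set.Icc (0 : ℝ) 1 →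
      gl u 0 h = 0 ∧ gl (u.1, 0) s h = 0 ∧ gl (0, u.2) s h = 0)
    (hκlbd : ∀ u : ℝ × ℝ, ∀ s ∈ Set.Icc (0 : ℝ) 1, ∀ h ∈ H,
      u.1 ∈ Set.Icc (0 : ℝ) 1 → u.2 ∈ Set.Icc (0 : ℝ) 1 →
      κl u 0 h = 0 ∧ κl (u.1, 0) s h = 0 ∧ κl (0, u.2) s h = 0 ∧ κl (1, 1) s h = 0 ∧
      ((u.1 = 0 ∨ u.1 = 1) → κl (u.1, 1) s h = 0) ∧
      ((u.2 = 0 ∨ u.2 = 1) → κl (1, u.2) s h = 0))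
    -- (g_n, κ_n) → (gl, κl) uniformly on E
    (hconv : ∀ ε : ℝ, 0 < ε → ∃ N : ℕ, ∀ n ≥ N,
      ∀ u : ℝ × ℝ, ∀ s ∈ Set.Icc (0 : ℝ) 1, ∀ h ∈ H,
      u.1 ∈ Set.Icc (0 : ℝ) 1 → u.2 ∈ Set.Icc (0 : ℝ) 1 →
      (∀ i, |g n u s h i - gl u s h i| ≤ ε) ∧ |κ n u s h - κl u s h| ≤ ε)
    -- (G_{0,n} + n^{−1/2} g_n, K_{0,n} + n^{−1/2} κ_n) ∈ 𝒜_n for every n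
    (hmem : ∀ n : ℕ, memDomainAn n H
      (fun u s h i => timeFrac n s * μv i * C u + (Real.sqrt n)⁻¹ * g n u s h i)
      (fun u s h => timeFrac n s * C u + (Real.sqrt n)⁻¹ * κ n u s h)) :
    -- conclusion: uniform convergence of Υ_n(g_n,κ_n) on E to the Hadamard derivative
    ∀ ε : ℝ, 0 < ε → ∃ N : ℕ, ∀ n ≥ N,
      ∀ u : ℝ × ℝ, ∀ s ∈ Set.Icc (0 : ℝ) 1, ∀ h ∈ H,
      u.1 ∈ Set.Icc (0 : ℝ) 1 → u.2 ∈ Set.Icc (0 : ℝ) 1 → ∀ i : Fin k,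
      |Real.sqrt n *
          (rankMap n
              (fun u' s' h' i' =>
                timeFrac n s' * μv i' * C u' + (Real.sqrt n)⁻¹ * g n u' s' h' i')
              (fun u' s' h' => timeFrac n s' * C u' + (Real.sqrt n)⁻¹ * κ n u' s' h')
              u s h i -
            rankMap n (fun u' s' _ i' => timeFrac n s' * μv i' * C u')
              (fun u' s' _ => timeFrac n s' * C u') u s h i) -
        (gl u s h i - μv i * (D₁ u * κl (u.1, 1) s h + D₂ u * κl (1, u.2) s h))| ≤ ε := by
  have hLip1 : ∀ a ∈ Set.Icc (0:ℝ) 1, ∀ a' ∈ Set.Icc (0:ℝ) 1, ∀ b ∈ Set.Icc (0:ℝ) 1,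
      |C (a, b) - C (a', b)| ≤ |a - a'| := by
    have key : ∀ a ∈ Set.Icc (0:ℝ) 1, ∀ a' ∈ Set.Icc (0:ℝ) 1, ∀ b ∈ Set.Icc (0:ℝ) 1, a' ≤ a →
        |C (a, b) - C (a', b)| ≤ |a - a'| := by
      intro a ha a' ha' b hb hle
      have h1 := hCinc a' a 0 b ha'.1 hle ha.2 le_rfl hb.1 hb.2
      have h2 := hCinc a' a b 1 ha'.1 hle ha.2 hb.1 hb.2 le_rfl
      rw [(hCground a ha).1, (hCground a' ha').1] at h1
      rw [(hCmarg a ha).1, (hCmarg a' ha').1] at h2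
      rw [abs_of_nonneg (by linarith), abs_of_nonneg (by linarith)]
      linarith
    intro a ha a' ha' b hb
    rcases le_total a' a with h | h
    · exact key a ha a' ha' b hb h
    · rw [abs_sub_comm, abs_sub_comm a]; exact key a' ha' a ha b hb h
  have hLip2 : ∀ a ∈ Set.Icc (0:ℝ) 1, ∀ a' ∈ Set.Icc (0:ℝ) 1, ∀ b ∈ Set.Icc (0:ℝ) 1,
      |(fun p : ℝ × ℝ => C p.swap) (a, b) - (fun p : ℝ × ℝ => C p.swap) (a', b)| ≤ |a - a'| := by
    have key : ∀ a ∈ Set.Icc (0:ℝ) 1, ∀ a' ∈ Set.Icc (0:ℝ) 1, ∀ b ∈ Set.Icc (0:ℝ) 1, a' ≤ a →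
        |C (b, a) - C (b, a')| ≤ |a - a'| := by
      intro a ha a' ha' b hb hle
      have h1 := hCinc 0 b a' a le_rfl hb.1 hb.2 ha'.1 hle ha.2
      have h2 := hCinc b 1 a' a hb.1 hb.2 le_rfl ha'.1 hle ha.2
      rw [(hCground a ha).2, (hCground a' ha').2] at h1
      rw [(hCmarg a ha).2, (hCmarg a' ha').2] at h2
      rw [abs_of_nonneg (by linarith), abs_of_nonneg (by linarith)]
      linarith
    intro a ha a' ha' b hb
    simp only [Prod.swap_prod_mk]
    rcases le_total a' a with h | h
    · exact key a ha a' ha' b hb h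
    · rw [abs_sub_comm, abs_sub_comm a]; exact key a' ha' a ha b hb h
  have hD2' : ∀ u : ℝ × ℝ, u.1 ∈ Set.Ioo (0 : ℝ) 1 → u.2 ∈ Set.Icc (0 : ℝ) 1 →
      HasDerivAt (fun x => (fun p : ℝ × ℝ => C p.swap) (x, u.2))
        ((fun p : ℝ × ℝ => D₂ p.swap) u) u.1 := fun u h1 h2 => hD₂ u.swap h1 h2
  have hD2c' : ContinuousOn (fun p : ℝ × ℝ => D₂ p.swap)
      {u : ℝ × ℝ | u.1 ∈ Set.Ioo (0 : ℝ) 1 ∧ u.2 ∈ Set.Icc (0 : ℝ) 1} :=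
    hD₂cont.comp continuous_swap.continuousOn (fun u hu => hu)
  set E : Set ((ℝ × ℝ) × ℝ × (Fin d → ℝ)) := {x | x.1.1 ∈ Set.Icc (0 : ℝ) 1 ∧
        x.1.2 ∈ Set.Icc (0 : ℝ) 1 ∧ x.2.1 ∈ Set.Icc (0 : ℝ) 1 ∧ x.2.2 ∈ H} with hEdef
  have hE : IsCompact E := by
    have : E = (Set.Icc (0:ℝ) 1 ×ˢ Set.Icc (0:ℝ) 1) ×ˢ (Set.Icc (0:ℝ) 1 ×ˢ H) := by
      ext ⟨⟨a, b⟩, s, h⟩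
      simp only [hEdef, Set.mem_ofPred_eq, Set.mem_prod]
      tauto
    rw [this]
    exact (isCompact_Icc.prod isCompact_Icc).prod (isCompact_Icc.prod hH)
  obtain ⟨B, hBd⟩ : ∃ B : ℝ, ∀ x ∈ E, |κl x.1 x.2.1 x.2.2| ≤ B := by
    obtain ⟨B, hB⟩ := hE.exists_bound_of_continuousOn hκlcont
    exact ⟨B, fun x hx => by simpa using hB x hx⟩
  replace hBd : ∃ B : ℝ, 0 ≤ B ∧ ∀ x ∈ E, |κl x.1 x.2.1 x.2.2| ≤ B :=
    ⟨|B|, abs_nonneg _, fun x hx => (hBd x hx).trans (le_abs_self _)⟩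
  clear B
  obtain ⟨B, hB0, hBd⟩ := hBd
  intro ε hε
  suffices hmain : ∀ i : Fin k, ∀ᶠ n : ℕ in atTop,
      ∀ u : ℝ × ℝ, ∀ s ∈ Set.Icc (0 : ℝ) 1, ∀ h ∈ H,
      u.1 ∈ Set.Icc (0 : ℝ) 1 → u.2 ∈ Set.Icc (0 : ℝ) 1 →
      |Real.sqrt n *
          (rankMap n
              (fun u' s' h' i' =>
                timeFrac n s' * μv i' * C u' + (Real.sqrt n)⁻¹ * g n u' s' h' i')
              (fun u' s' h' => timeFrac n s' * C u' + (Real.sqrt n)⁻¹ * κ n u' s' h')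
              u s h i -
            rankMap n (fun u' s' _ i' => timeFrac n s' * μv i' * C u')
              (fun u' s' _ => timeFrac n s' * C u') u s h i) -
        (gl u s h i - μv i * (D₁ u * κl (u.1, 1) s h + D₂ u * κl (1, u.2) s h))| ≤ ε by
    obtain ⟨N, hN⟩ := eventually_atTop.1 (eventually_all.2 hmain)
    exact ⟨N, fun n hn u s hs h hh h1 h2 i => hN n hn i u s hs h hh h1 h2⟩
  intro i
  obtain ⟨η, hη, hηε⟩ : ∃ η > 0, |μv i| * (2 * ((B + 4) * η)) + 3 * η ≤ ε := by
    have hpos : 0 < |μv i| * (2 * (B + 4)) + 3 := by positivity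
    refine ⟨ε / (|μv i| * (2 * (B + 4)) + 3), by positivity, le_of_eq ?_⟩
    field_simp
  obtain ⟨δκ, hδκ, hκu⟩ := aux_uc hE hκlcont η hη
  obtain ⟨δg, hδg, hgu⟩ := aux_uc hE (hglcont i) η hη
  set δ₁ := min δκ δg with hδ₁def
  have hδ₁ : 0 < δ₁ := lt_min hδκ hδg
  obtain ⟨δa, hδa, hca⟩ := aux_coord C D₁ hLip1 hD₁ hD₁cont η δ₁ B hη hδ₁
  obtain ⟨δb, hδb, hcb⟩ := aux_coord (fun p : ℝ × ℝ => C p.swap) (fun p : ℝ × ℝ => D₂ p.swap) hLip2 hD2' hD2c' η δ₁ B hη hδ₁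
  set δ := min δ₁ (min δa δb) with hδdef
  have hδ : 0 < δ := lt_min hδ₁ (lt_min hδa hδb)
  obtain ⟨N, hN⟩ := hconv η hη
  have hsq : Tendsto (fun n : ℕ => Real.sqrt n) atTop atTop :=
    Real.tendsto_sqrt_atTop.comp tendsto_natCast_atTop_atTop
  filter_upwards [eventually_ge_atTop N, eventually_gt_atTop 0,
    tendsto_natCast_atTop_atTop.eventually_ge_atTop (2 / δ₁),
    hsq.eventually_gt_atTop ((B + η) / (δ₁ / 2 * δ))] with n hnN hn0 hnδ hnsq
  intro u s hs h hh hu1 hu2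
  have hnR : (0:ℝ) < n := by exact_mod_cast hn0
  have hr : 0 < Real.sqrt n := Real.sqrt_pos.2 hnR
  obtain ⟨u₁, u₂⟩ := u
  simp only at hu1 hu2 ⊢
  have hbd := hκlbd (u₁, u₂) s hs h hh hu1 hu2
  by_cases hs0 : s = 0
  · subst hs0
    have e1 := (hglbd (u₁, u₂) 0 hs h hh hu1 hu2).1
    have e2 := (hκlbd (u₁, 1) 0 hs h hh hu1 (by simp)).1
    have e3 := (hκlbd (1, u₂) 0 hs h hh (by simp) hu2).1
    simp [rankMap, e1, e2, e3, hε.le]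
  set a := timeFrac n s with ha
  have ha0 : 0 ≤ a := by rw [ha, timeFrac]; positivity
  have hone : (1:ℝ) ∈ Set.Icc (0:ℝ) 1 := by simp
  have hzero : (0:ℝ) ∈ Set.Icc (0:ℝ) 1 := by simp
  -- generalized inverses of the perturbed margins
  have hK11 := ((hmem n).2.2 s hs h hh).2.2
  beta_reduce at hK11
  rw [(hCmarg 1 hone).1] at hK11
  have hinv1 := aux_inv (fun y => κl (y, 1) s h) (fun y => κ n (y, 1) s h) a (Real.sqrt n)⁻¹ η u₁
    (hκlcont.comp (f := fun y : ℝ => (((y, 1), s, h) : (ℝ × ℝ) × ℝ × (Fin d → ℝ)))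
      (by fun_prop) (fun y hy => ⟨hy, hone, hs, hh⟩))
    ((hκlbd (0, 1) s hs h hh hzero hone).2.2.1)
    (fun y hy => (hN n hnN (y, 1) s hs h hh hy hone).2) ha0 (by positivity) hu1 hK11
  have hinv2 := aux_inv (fun y => κl (1, y) s h) (fun y => κ n (1, y) s h) a (Real.sqrt n)⁻¹ η u₂
    (hκlcont.comp (f := fun y : ℝ => (((1, y), s, h) : (ℝ × ℝ) × ℝ × (Fin d → ℝ)))
      (by fun_prop) (fun y hy => ⟨hone, hy, hs, hh⟩))
    ((hκlbd (1, 0) s hs h hh hone hzero).2.1)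
    (fun y hy => (hN n hnN (1, y) s hs h hh hone hy).2) ha0 (by positivity) hu2 hK11
  have hg1 : genInv n (fun x s' h' => timeFrac n s' * C (x, 1) + (Real.sqrt n)⁻¹ * κ n (x, 1) s' h')
      u₁ s h = sInf {y : ℝ | y ∈ Set.Icc (0:ℝ) 1 ∧ a * u₁ ≤ a * y + (Real.sqrt n)⁻¹ * κ n (y, 1) s h} := by
    rw [genInv, if_neg hs0]
    congr 1; ext y
    refine and_congr_right fun hy => ?_
    rw [(hCmarg y hy).1]
  have hg2 : genInv n (fun x s' h' => timeFrac n s' * C (1, x) + (Real.sqrt n)⁻¹ * κ n (1, x) s' h')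
      u₂ s h = sInf {y : ℝ | y ∈ Set.Icc (0:ℝ) 1 ∧ a * u₂ ≤ a * y + (Real.sqrt n)⁻¹ * κ n (1, y) s h} := by
    rw [genInv, if_neg hs0]
    congr 1; ext y
    refine and_congr_right fun hy => ?_
    rw [(hCmarg y hy).2]
  have h0inv : ∀ x ∈ Set.Icc (0:ℝ) 1, 0 < a → sInf {y : ℝ | y ∈ Set.Icc (0:ℝ) 1 ∧ a * x ≤ a * y} = x := by
    intro x hx hapos
    refine IsLeast.csInf_eq ⟨⟨hx, le_rfl⟩, fun y hy => le_of_mul_le_mul_left hy.2 hapos⟩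
  have h0g1 : 0 < a → genInv n (fun x s' (_ : Fin d → ℝ) => timeFrac n s' * C (x, 1)) u₁ s h = u₁ := by
    intro hapos
    rw [genInv, if_neg hs0]
    refine Eq.trans ?_ (h0inv u₁ hu1 hapos)
    congr 1; ext y
    refine and_congr_right fun hy => ?_
    rw [(hCmarg y hy).1]
  have h0g2 : 0 < a → genInv n (fun x s' (_ : Fin d → ℝ) => timeFrac n s' * C (1, x)) u₂ s h = u₂ := by
    intro hapos
    rw [genInv, if_neg hs0]
    refine Eq.trans ?_ (h0inv u₂ hu2 hapos)
    congr 1; ext y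
    refine and_congr_right fun hy => ?_
    rw [(hCmarg y hy).2]
  have hrm0 : rankMap n (fun u' s' _ i' => timeFrac n s' * μv i' * C u')
      (fun u' s' (_ : Fin d → ℝ) => timeFrac n s' * C u') (u₁, u₂) s h i = a * μv i * C (u₁, u₂) := by
    rw [rankMap, if_neg hs0]
    rcases eq_or_lt_of_le ha0 with h0 | h0
    · simp only [← ha, ← h0, zero_mul]
    · simp only [h0g1 h0, h0g2 h0, ← ha]
  rw [hrm0, rankMap, if_neg hs0]
  simp only [hg1, hg2, ← ha]
  clear hg1 hg2 h0g1 h0g2 h0inv hrm0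
  revert hinv1 hinv2
  generalize sInf {y : ℝ | y ∈ Set.Icc (0:ℝ) 1 ∧ a * u₁ ≤ a * y + (Real.sqrt n)⁻¹ * κ n (y, 1) s h} = v₁
  generalize sInf {y : ℝ | y ∈ Set.Icc (0:ℝ) 1 ∧ a * u₂ ≤ a * y + (Real.sqrt n)⁻¹ * κ n (1, y) s h} = v₂
  rintro ⟨hv1, hq1⟩ ⟨hv2, hq2⟩
  set r := Real.sqrt n with hrdef
  have hscale : ∀ x v c : ℝ, |a * (v - x) + r⁻¹ * c| ≤ r⁻¹ * η → |r * a * (v - x) + c| ≤ η := by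
    intro x v c hx
    have e : r * a * (v - x) + c = r * (a * (v - x) + r⁻¹ * c) := by field_simp
    rw [e, abs_mul, abs_of_pos hr]
    calc r * |a * (v - x) + r⁻¹ * c| ≤ r * (r⁻¹ * η) := mul_le_mul_of_nonneg_left hx hr.le
      _ = η := by field_simp
  replace hq1 := hscale _ _ _ hq1
  replace hq2 := hscale _ _ _ hq2
  have hA0 : 0 ≤ r * a := by positivity
  have hgn := (hN n hnN (v₁, v₂) s hs h hh hv1 hv2).1 i
  have hc1 : u₁ = 0 ∨ u₁ = 1 → κl (u₁, 1) s h = 0 := hbd.2.2.2.2.1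
  have hc2 : u₂ = 0 ∨ u₂ = 1 → κl (1, u₂) s h = 0 := hbd.2.2.2.2.2
  -- it suffices to bound the three pieces
  suffices hpieces : |r * a * (C (v₁, v₂) - C (u₁, v₂)) + D₁ (u₁, u₂) * κl (u₁, 1) s h| ≤ (B + 4) * η ∧
      |r * a * (C (u₁, v₂) - C (u₁, u₂)) + D₂ (u₁, u₂) * κl (1, u₂) s h| ≤ (B + 4) * η ∧
      |gl (v₁, v₂) s h i - gl (u₁, u₂) s h i| ≤ 2 * η by
    obtain ⟨p1, p2, p3⟩ := hpieces
    have e : r * (a * μv i * C (v₁, v₂) + r⁻¹ * g n (v₁, v₂) s h i - a * μv i * C (u₁, u₂)) -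
        (gl (u₁, u₂) s h i - μv i * (D₁ (u₁, u₂) * κl (u₁, 1) s h + D₂ (u₁, u₂) * κl (1, u₂) s h)) =
        μv i * ((r * a * (C (v₁, v₂) - C (u₁, v₂)) + D₁ (u₁, u₂) * κl (u₁, 1) s h) +
          (r * a * (C (u₁, v₂) - C (u₁, u₂)) + D₂ (u₁, u₂) * κl (1, u₂) s h)) +
        ((g n (v₁, v₂) s h i - gl (v₁, v₂) s h i) + (gl (v₁, v₂) s h i - gl (u₁, u₂) s h i)) := by
      field_simp; ring
    rw [e]
    refine (abs_add_le _ _).trans (le_trans (add_le_add ?_ ?_) hηε)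
    · rw [abs_mul]
      refine mul_le_mul_of_nonneg_left ?_ (abs_nonneg _)
      exact (abs_add_le _ _).trans (by linarith)
    · exact (abs_add_le _ _).trans (by linarith)
  have hκd : ∀ x ∈ E, ∀ y ∈ E, dist x y < δ₁ → |κl x.1 x.2.1 x.2.2 - κl y.1 y.2.1 y.2.2| < η :=
    fun x hx y hy hd => hκu x hx y hy (hd.trans_le (min_le_left _ _))
  have hgd : ∀ x ∈ E, ∀ y ∈ E, dist x y < δ₁ → |gl x.1 x.2.1 x.2.2 i - gl y.1 y.2.1 y.2.2 i| < η :=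
    fun x hx y hy hd => hgu x hx y hy (hd.trans_le (min_le_right _ _))
  by_cases hsδ : s < δ₁
  · -- small times
    have hsmall : ∀ w : ℝ × ℝ, w.1 ∈ Set.Icc (0:ℝ) 1 → w.2 ∈ Set.Icc (0:ℝ) 1 →
        |κl w s h| ≤ η ∧ |gl w s h i| ≤ η := by
      intro w hw1 hw2
      have hd : dist ((w, s, h) : (ℝ × ℝ) × ℝ × (Fin d → ℝ)) (w, 0, h) < δ₁ := by
        simp [Prod.dist_eq, Real.dist_eq, abs_of_nonneg hs.1, hsδ, hδ₁]
      have m1 : ((w, s, h) : (ℝ × ℝ) × ℝ × (Fin d → ℝ)) ∈ E := ⟨hw1, hw2, hs, hh⟩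
      have m2 : ((w, 0, h) : (ℝ × ℝ) × ℝ × (Fin d → ℝ)) ∈ E := ⟨hw1, hw2, hzero, hh⟩
      have k1 := hκd _ m1 _ m2 hd
      have k2 := hgd _ m1 _ m2 hd
      simp only [(hκlbd w s hs h hh hw1 hw2).1, (hglbd w s hs h hh hw1 hw2).1, Pi.zero_apply,
        sub_zero] at k1 k2
      exact ⟨k1.le, k2.le⟩
    have hshift : ∀ x v c : ℝ, |r * a * (v - x) + c| ≤ η → |c| ≤ η →
        |r * a * (v - x)| ≤ 3 * η := by
      intro x v c h1 h2
      rw [abs_le] at *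
      constructor <;> linarith [h1.1, h1.2, h2.1, h2.2]
    refine ⟨?_, ?_, ?_⟩
    · exact aux_bdry C D₁ hLip1 hD₁ η B hη hB0 u₁ u₂ v₁ v₂ hu1 hu2 hv1 hv2 (r * a) _ hc1
        (hshift _ _ _ hq1 (hsmall (v₁, 1) hv1 hone).1) (hsmall (u₁, 1) hu1 hone).1
    · exact aux_bdry (fun p : ℝ × ℝ => C p.swap) (fun p : ℝ × ℝ => D₂ p.swap) hLip2 hD2' η B hη hB0
        u₂ u₁ v₂ u₁ hu2 hu1 hv2 hu1 (r * a) _ hc2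
        (hshift _ _ _ hq2 (hsmall (1, v₂) hone hv2).1) (hsmall (1, u₂) hone hu2).1
    · have k1 := (hsmall (v₁, v₂) hv1 hv2).2
      have k2 := (hsmall (u₁, u₂) hu1 hu2).2
      exact (abs_sub _ _).trans (by linarith)
  · -- times bounded away from zero
    push Not at hsδ
    have haδ : δ₁ / 2 ≤ a := by
      have h1 : s * n < ⌊s * (n:ℝ)⌋₊ + 1 := Nat.lt_floor_add_one _
      have h2 : 1 ≤ δ₁ / 2 * n := by
        rw [div_le_iff₀ hδ₁] at hnδ
        linarith
      have h3 : δ₁ * n ≤ s * n := mul_le_mul_of_nonneg_right hsδ hnR.le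
      rw [ha, timeFrac, le_div_iff₀ hnR]
      linarith
    have hclose : ∀ x v c : ℝ, |r * a * (v - x) + c| ≤ η → |c| ≤ B → |v - x| < δ := by
      intro x v c h1 h2
      have h3 : |r * a * (v - x)| ≤ B + η := by
        have := abs_sub (r * a * (v - x) + c) c
        rw [add_sub_cancel_right] at this
        linarith
      rw [abs_mul, abs_of_nonneg hA0] at h3
      rw [div_lt_iff₀ (by positivity)] at hnsq
      by_contra hcon
      push Not at hcon
      have h4 : r * (δ₁ / 2) * δ ≤ r * a * |v - x| :=
        mul_le_mul (mul_le_mul_of_nonneg_left haδ hr.le) hcon hδ.le hA0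
      linarith
    have hb : ∀ w : ℝ × ℝ, w.1 ∈ Set.Icc (0:ℝ) 1 → w.2 ∈ Set.Icc (0:ℝ) 1 → |κl w s h| ≤ B :=
      fun w h1 h2 => hBd (w, s, h) ⟨h1, h2, hs, hh⟩
    have hd1 := hclose _ _ _ hq1 (hb (v₁, 1) hv1 hone)
    have hd2 := hclose _ _ _ hq2 (hb (1, v₂) hone hv2)
    have hδ1' : δ ≤ δ₁ := min_le_left _ _
    have hδa' : δ ≤ δa := (min_le_right _ _).trans (min_le_left _ _)
    have hδb' : δ ≤ δb := (min_le_right _ _).trans (min_le_right _ _)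
    have hκ2 : ∀ w z : ℝ × ℝ, w.1 ∈ Set.Icc (0:ℝ) 1 → w.2 ∈ Set.Icc (0:ℝ) 1 →
        z.1 ∈ Set.Icc (0:ℝ) 1 → z.2 ∈ Set.Icc (0:ℝ) 1 → |w.1 - z.1| < δ₁ → |w.2 - z.2| < δ₁ →
        |κl w s h - κl z s h| ≤ η ∧ |gl w s h i - gl z s h i| ≤ η := by
      intro w z hw1 hw2 hz1 hz2 h1 h2
      have hd : dist ((w, s, h) : (ℝ × ℝ) × ℝ × (Fin d → ℝ)) (z, s, h) < δ₁ := by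
        simp [Prod.dist_eq, Real.dist_eq, h1, h2, hδ₁]
      have m1 : ((w, s, h) : (ℝ × ℝ) × ℝ × (Fin d → ℝ)) ∈ E := ⟨hw1, hw2, hs, hh⟩
      have m2 : ((z, s, h) : (ℝ × ℝ) × ℝ × (Fin d → ℝ)) ∈ E := ⟨hz1, hz2, hs, hh⟩
      exact ⟨(hκd _ m1 _ m2 hd).le, (hgd _ m1 _ m2 hd).le⟩
    have h00 : |(1:ℝ) - 1| < δ₁ := by simpa using hδ₁
    have hsum : ∀ x v c c' : ℝ, |r * a * (v - x) + c'| ≤ η → |c' - c| ≤ η →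
        |r * a * (v - x) + c| ≤ 2 * η := by
      intro x v c c' h1 h2
      rw [abs_le] at *
      constructor <;> linarith [h1.1, h1.2, h2.1, h2.2]
    refine ⟨?_, ?_, ?_⟩
    · refine hca u₁ hu1 u₂ hu2 v₁ hv1 v₂ hv2 (r * a) _ hA0 (hd1.trans_le hδa') (hd2.trans_le hδa')
        (hb (u₁, 1) hu1 hone) ?_ ?_ hc1
        (hsum _ _ _ _ hq1 (hκ2 (v₁, 1) (u₁, 1) hv1 hone hu1 hone (hd1.trans_le hδ1') h00).1)
      · intro hlt
        have := (hκ2 (u₁, 1) (0, 1) hu1 hone hzero hone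
          (by simpa [abs_of_nonneg hu1.1] using hlt) h00).1
        rwa [(hκlbd (0, 1) s hs h hh hzero hone).2.2.1, sub_zero] at this
      · intro hlt
        have := (hκ2 (u₁, 1) (1, 1) hu1 hone hone hone
          (by rw [abs_sub_comm, abs_of_nonneg (by linarith [hu1.2])]; linarith) h00).1
        rwa [hbd.2.2.2.1, sub_zero] at this
    · refine hcb u₂ hu2 u₁ hu1 v₂ hv2 u₁ hu1 (r * a) _ hA0 (hd2.trans_le hδb')
        (by simpa using hδb)
        (hb (1, u₂) hone hu2) ?_ ?_ hc2
        (hsum _ _ _ _ hq2 (hκ2 (1, v₂) (1, u₂) hone hv2 hone hu2 h00 (hd2.trans_le hδ1')).1)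
      · intro hlt
        have := (hκ2 (1, u₂) (1, 0) hone hu2 hone hzero h00
          (by simpa [abs_of_nonneg hu2.1] using hlt)).1
        rwa [(hκlbd (1, 0) s hs h hh hone hzero).2.1, sub_zero] at this
      · intro hlt
        have := (hκ2 (1, u₂) (1, 1) hone hu2 hone hone h00
          (by rw [abs_sub_comm, abs_of_nonneg (by linarith [hu2.2])]; linarith)).1
        rwa [hbd.2.2.2.1, sub_zero] at this
    · have := (hκ2 (v₁, v₂) (u₁, u₂) hv1 hv2 hu1 hu2 (hd1.trans_le hδ1') (hd2.trans_le hδ1')).2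
      linarith
end
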